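/- arXiv:0809.0415 — 7 statements merged into one kernel-verified Lean document; each statement's English description precedes it below -/
import Mathlib

section
/- Let A be a commutative ring, R an A-algebra, B a commutative A-algebra, and D : R → B a multiplicative A-polynomial law which is homogeneous of degree d. Then for all r, r' ∈ R one has D(1 + rr') = D(1 + r'r) in B. -/
open TensorProduct

/-- An `A`-polynomial law between the `A`-modules `M` and `N` : a family of maps
`B ⊗[A] M → B ⊗[A] N` indexed by the commutative `A`-algebras `B`, natural in `B`. -/
structure PolyLaw (A : Type) [CommRing A] (M : Type) [AddCommGroup M] [Module A M]
    (N : Type) [AddCommGroup N] [Module A N] where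
  toFun : ∀ (B : Type) [CommRing B] [Algebra A B], B ⊗[A] M → B ⊗[A] N
  isCompat : ∀ (B : Type) [CommRing B] [Algebra A B] (C : Type) [CommRing C] [Algebra A C]
      (φ : B →ₐ[A] C) (x : B ⊗[A] M),
      toFun C (LinearMap.rTensor M φ.toLinearMap x) = LinearMap.rTensor N φ.toLinearMap (toFun B x)

namespace PolyLaw

variable {A : Type} [CommRing A]

/-- `P` is homogeneous of degree `d` if `P (b • x) = b ^ d • P x` over every base change. -/
def IsHomogeneous {M N : Type} [AddCommGroup M] [Module A M] [AddCommGroup N] [Module A N]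
    (P : PolyLaw A M N) (d : ℕ) : Prop :=
  ∀ (B : Type) [CommRing B] [Algebra A B] (b : B) (x : B ⊗[A] M),
    P.toFun B (b • x) = b ^ d • P.toFun B x

/-- A polynomial law between `A`-algebras is multiplicative if it sends `1` to `1` and
products to products, over every base change. -/
def IsMultiplicative {R S : Type} [Ring R] [Algebra A R] [Ring S] [Algebra A S]
    (P : PolyLaw A R S) : Prop :=
  (∀ (B : Type) [CommRing B] [Algebra A B], P.toFun B 1 = 1) ∧
  ∀ (B : Type) [CommRing B] [Algebra A B] (x y : B ⊗[A] R),
    P.toFun B (x * y) = P.toFun B x * P.toFun B y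

/-- The kernel of a polynomial law. -/
def ker {M N : Type} [AddCommGroup M] [Module A M] [AddCommGroup N] [Module A N]
    (P : PolyLaw A M N) : Set M :=
  {x | ∀ (B : Type) [CommRing B] [Algebra A B] (b : B) (m : B ⊗[A] M),
    P.toFun B (b ⊗ₜ[A] x + m) = P.toFun B m}

/-- Evaluation of a polynomial law at an element of `M` (over the base `A` itself). -/
noncomputable def ground {M N : Type} [AddCommGroup M] [Module A M] [AddCommGroup N] [Module A N]
    (P : PolyLaw A M N) (m : M) : N :=
  TensorProduct.lid A N (P.toFun A ((1 : A) ⊗ₜ[A] m))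

end PolyLaw

namespace PolyLaw

variable {A R B : Type} [CommRing A] [Ring R] [Algebra A R] [CommRing B] [Algebra A B]

/-- A polynomial law with values in a commutative algebra `B`, evaluated over a `B`-algebra `C`
and contracted to `C` along `C ⊗[A] B → C`. -/
noncomputable def eval (D : PolyLaw A R B) (C : Type) [CommRing C] [Algebra A C] [Algebra B C]
    [IsScalarTower A B C] (x : C ⊗[A] R) : C :=
  Algebra.TensorProduct.productMap (AlgHom.id A C) (IsScalarTower.toAlgHom A B C) (D.toFun C x)

variable {D : PolyLaw A R B} {C : Type} [CommRing C] [Algebra A C] [Algebra B C]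
  [IsScalarTower A B C] {C' : Type} [CommRing C'] [Algebra A C'] [Algebra B C']
  [IsScalarTower A B C']

theorem IsMultiplicative.eval_one (hD : D.IsMultiplicative) : D.eval C 1 = 1 := by
  simp [eval, hD.1]

theorem IsMultiplicative.eval_mul (hD : D.IsMultiplicative) (x y : C ⊗[A] R) :
    D.eval C (x * y) = D.eval C x * D.eval C y := by
  simp [eval, hD.2]

theorem IsHomogeneous.eval_smul {d : ℕ} (hD : D.IsHomogeneous d) (c : C) (x : C ⊗[A] R) :
    D.eval C (c • x) = c ^ d * D.eval C x := by
  rw [eval, hD, Algebra.smul_def, map_mul, Algebra.TensorProduct.algebraMap_apply,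
    Algebra.TensorProduct.productMap_apply_tmul]
  simp [eval]

theorem map_eval (D : PolyLaw A R B) (φ : C →ₐ[B] C') (x : C ⊗[A] R) :
    φ (D.eval C x) = D.eval C' (Algebra.TensorProduct.map (φ.restrictScalars A) (.id A R) x) := by
  have h := D.isCompat C C' (φ.restrictScalars A) x
  change _ = Algebra.TensorProduct.productMap _ _
    (D.toFun C' (LinearMap.rTensor R (φ.restrictScalars A).toLinearMap x))
  rw [h, eval]
  induction D.toFun C x using TensorProduct.induction_on with
  | zero => simp
  | tmul c b => simp
  | add y z hy hz => simp only [map_add, hy, hz]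

theorem ground_eq_eval (D : PolyLaw A R B) (r : R) : D.ground r = D.eval B (1 ⊗ₜ r) := by
  have h := D.isCompat A B (Algebra.ofId A B) (1 ⊗ₜ r)
  rw [LinearMap.rTensor_tmul, AlgHom.toLinearMap_apply, map_one] at h
  rw [eval, h, ground]
  induction D.toFun A (1 ⊗ₜ r) using TensorProduct.induction_on with
  | zero => simp
  | tmul a b => simp [Algebra.ofId_apply, Algebra.smul_def]
  | add y z hy hz => simp only [map_add, hy, hz]

open Polynomial LaurentPolynomial

theorem IsMultiplicative.isLeftRegular_eval_one_add_X_tmul (hD : D.IsMultiplicative) (r : R) :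
    IsLeftRegular (D.eval B[X] (1 + X ⊗ₜ r)) := by
  have h : (D.eval B[X] (1 + X ⊗ₜ r)).coeff 0 = 1 := by
    have := D.map_eval (Polynomial.aeval (0 : B)) (1 + X ⊗ₜ r)
    simpa [hD.eval_one, Polynomial.coeff_zero_eq_aeval_zero] using this
  have hmem : D.eval B[X] (1 + X ⊗ₜ r) ∈ nonZeroDivisors B[X] :=
    Polynomial.mem_nonzeroDivisors_of_coeff_mem 0 (h ▸ one_mem _)
  exact (isRegular_iff_mem_nonZeroDivisors.2 hmem).left

/-- The identity `D (s + (1 + s r) r') = D (s + r' (1 + s r))` over `B[s]`. -/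
theorem IsMultiplicative.eval_X_add_comm (hD : D.IsMultiplicative) (r r' : R) :
    D.eval B[X] (X ⊗ₜ 1 + (1 + X ⊗ₜ r) * 1 ⊗ₜ r') =
      D.eval B[X] (X ⊗ₜ 1 + 1 ⊗ₜ r' * (1 + X ⊗ₜ r)) := by
  refine hD.isLeftRegular_eval_one_add_X_tmul r ?_
  dsimp only
  rw [mul_comm, ← hD.eval_mul, ← hD.eval_mul]
  congr 1
  simp only [add_mul, mul_add, Algebra.TensorProduct.tmul_mul_tmul, one_mul, mul_one, mul_assoc]
  abel

end PolyLaw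

/-- If `D : R → B` is a multiplicative homogeneous `A`-polynomial law of
degree `d`, then `D(1 + r r') = D(1 + r' r)` in `B` for all `r, r' ∈ R`. -/
theorem det_one_add_mul_comm (A R B : Type) [CommRing A] [Ring R] [Algebra A R]
    [CommRing B] [Algebra A B] (d : ℕ)
    (D : PolyLaw A R B) (hhom : D.IsHomogeneous d) (hmul : D.IsMultiplicative)
    (r r' : R) :
    D.ground (1 + r * r') = D.ground (1 + r' * r) := by
  open PolyLaw Polynomial LaurentPolynomial in
  have hinv : ∀ y : R, (T 1 : B[T;T⁻¹]) • ((T (-1) : B[T;T⁻¹]) ⊗ₜ[A] y) = 1 ⊗ₜ y := by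
    intro y
    rw [TensorProduct.smul_tmul', smul_eq_mul, ← T_add]
    simp
  have hL := congrArg (fun p => T 1 ^ d * Polynomial.aeval (T (-1) : B[T;T⁻¹]) p)
    (hmul.eval_X_add_comm r r')
  have hX : D.eval B[X] (1 + (X ⊗ₜ 1 + 1 ⊗ₜ r) * 1 ⊗ₜ r') =
      D.eval B[X] (1 + 1 ⊗ₜ r' * (X ⊗ₜ 1 + 1 ⊗ₜ r)) := by
    apply Polynomial.toLaurent_injective
    change toLaurentAlg _ = toLaurentAlg _
    simp only [map_eval, ← hhom.eval_smul] at hL ⊢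
    simpa [add_mul, mul_add, smul_add, hinv, Algebra.TensorProduct.one_def,
      TensorProduct.smul_tmul'] using hL
  have h0 := congrArg (Polynomial.aeval (0 : B)) hX
  simp only [map_eval] at h0
  simpa [ground_eq_eval, TensorProduct.tmul_add, Algebra.TensorProduct.one_def] using h0
end

section
/- Let G be a monoid, A a commutative ring, and D a d-dimensional A-valued determinant on G, i.e. a multiplicative homogeneous degree-d Z-polynomial law Z[G] → A. Let B ⊆ A be the subring generated by the coefficients Λ_i(g) for all g ∈ G and 1 ≤ i ≤ d of the characteristic polynomials χ(g,t) = D(t − g). Then for every n ≥ 1 and all g₁, …, g_n ∈ G, the element D(g₁t₁ + … + g_n t_n) of A[t₁,…,t_n] lies in B[t₁,…,t_n]; consequently D factors through a (unique) B-valued determinant on G of dimension d. -/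
open TensorProduct

/-- The coefficient-extraction linear map on multivariate polynomials. -/
noncomputable def mvLcoeff {A : Type} [CommRing A] {n : ℕ} (α : Fin n →₀ ℕ) :
    MvPolynomial (Fin n) A →ₗ[A] A where
  toFun p := MvPolynomial.coeff α p
  map_add' p q := MvPolynomial.coeff_add α p q
  map_smul' a p := by simp [MvPolynomial.coeff_smul]

namespace PolyLaw

variable {k R S S' : Type} [CommRing k] [Ring R] [Algebra k R] [Ring S] [Algebra k S]
  [Ring S'] [Algebra k S']

theorem rTensor_mem_range_lTensor (ι : S' →ₗ[k] S) {C C' : Type} [CommRing C] [Algebra k C]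
    [CommRing C'] [Algebra k C'] (f : C →ₗ[k] C') {z : C ⊗[k] S}
    (hz : z ∈ LinearMap.range (ι.lTensor C)) :
    LinearMap.rTensor S f z ∈ LinearMap.range (ι.lTensor C') := by
  obtain ⟨w, rfl⟩ := hz
  refine ⟨LinearMap.rTensor S' f w, ?_⟩
  simp only [← LinearMap.comp_apply, LinearMap.rTensor_comp_lTensor,
    LinearMap.lTensor_comp_rTensor]

theorem mul_mem_range_lTensor (ι : S' →ₐ[k] S) {C : Type} [CommRing C] [Algebra k C]
    {x y : C ⊗[k] S} (hx : x ∈ LinearMap.range (ι.toLinearMap.lTensor C))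
    (hy : y ∈ LinearMap.range (ι.toLinearMap.lTensor C)) :
    x * y ∈ LinearMap.range (ι.toLinearMap.lTensor C) := by
  obtain ⟨v, rfl⟩ := hx
  obtain ⟨w, rfl⟩ := hy
  exact ⟨v * w, map_mul (Algebra.TensorProduct.map (AlgHom.id k C) ι) v w⟩

theorem one_mem_range_lTensor (ι : S' →ₐ[k] S) {C : Type} [CommRing C] [Algebra k C] :
    (1 : C ⊗[k] S) ∈ LinearMap.range (ι.toLinearMap.lTensor C) :=
  ⟨1, map_one (Algebra.TensorProduct.map (AlgHom.id k C) ι)⟩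

theorem rTensor_algHom_smul {M : Type} [AddCommGroup M] [Module k M] {C C' : Type} [CommRing C]
    [Algebra k C] [CommRing C'] [Algebra k C'] (f : C →ₐ[k] C') (c : C) (z : C ⊗[k] M) :
    LinearMap.rTensor M f.toLinearMap (c • z) = f c • LinearMap.rTensor M f.toLinearMap z := by
  induction z with
  | zero => simp
  | tmul a m => simp [TensorProduct.smul_tmul']
  | add x y hx hy => simp [smul_add, hx, hy]

theorem rTensor_algHom_one {C C' : Type} [CommRing C]
    [Algebra k C] [CommRing C'] [Algebra k C'] (f : C →ₐ[k] C') :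
    LinearMap.rTensor R f.toLinearMap (1 : C ⊗[k] R) = 1 := by
  simp [Algebra.TensorProduct.one_def]

section Nilpotent

variable {G : Type} [Monoid G] (b : G →* R) {C : Type} [CommRing C] [Algebra k C]

theorem ideal_smul_top_induction (hb : Submodule.span k (Set.range b) = ⊤) (I : Ideal C)
    {Q : C ⊗[k] R → Prop} (h_zero : Q 0) (h_add : ∀ x y, Q x → Q y → Q (x + y))
    (h_tmul : ∀ c ∈ I, ∀ g, Q (c ⊗ₜ b g)) {x : C ⊗[k] R}
    (hx : x ∈ I • (⊤ : Submodule C (C ⊗[k] R))) : Q x := by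
  refine Submodule.smul_induction_on (p := Q) hx (fun r hr n hn => ?_) h_add
  clear hn
  induction n with
  | zero => simpa using h_zero
  | add x y hx hy => rw [smul_add]; exact h_add _ _ hx hy
  | tmul c m =>
    rw [TensorProduct.smul_tmul', smul_eq_mul]
    have hm : m ∈ Submodule.span k (Set.range b) := by rw [hb]; exact Submodule.mem_top
    suffices h : ∀ c ∈ I, Q (c ⊗ₜ m) from h _ (I.mul_mem_right c hr)
    induction hm using Submodule.span_induction with
    | mem x h => obtain ⟨g, rfl⟩ := h; exact fun c hc => h_tmul c hc g
    | zero => exact fun c _ => by simpa using h_zero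
    | add x y _ _ hx hy =>
      intro c hc; rw [TensorProduct.tmul_add]; exact h_add _ _ (hx c hc) (hy c hc)
    | smul a x _ hx =>
      intro c hc
      rw [← TensorProduct.smul_tmul, Algebra.smul_def]
      exact hx _ (I.mul_mem_left _ hc)

theorem mul_mem_pow_smul_top (I : Ideal C) {m n p : ℕ} (h : p ≤ m + n) {x y : C ⊗[k] R}
    (hx : x ∈ I ^ m • (⊤ : Submodule C (C ⊗[k] R)))
    (hy : y ∈ I ^ n • (⊤ : Submodule C (C ⊗[k] R))) :
    x * y ∈ I ^ p • (⊤ : Submodule C (C ⊗[k] R)) := by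
  refine Submodule.smul_mono_left (Ideal.pow_le_pow_right h) ?_
  refine Submodule.smul_induction_on hx (fun r hr u _ => ?_)
    (fun x x' hx hx' => by rw [add_mul]; exact add_mem hx hx')
  refine Submodule.smul_induction_on hy (fun s hs v _ => ?_)
    (fun x x' hx hx' => by rw [mul_add]; exact add_mem hx hx')
  rw [smul_mul_smul_comm, pow_add]
  exact Submodule.smul_mem_smul (Ideal.mul_mem_mul hr hs) Submodule.mem_top

/-- If `I` is nilpotent, then `1 + I (C ⊗ R)` is generated, as a monoid, by the elements
`1 + c ⊗ b g` with `c ∈ I`. -/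
theorem one_add_mem_of_nilpotent (hb : Submodule.span k (Set.range b) = ⊤) (I : Ideal C) {N : ℕ}
    (hI : I ^ N = ⊥) (T : Submonoid (C ⊗[k] R)) (hT : ∀ c ∈ I, ∀ g, 1 + c ⊗ₜ b g ∈ T)
    {x : C ⊗[k] R} (hx : x ∈ I • (⊤ : Submodule C (C ⊗[k] R))) : 1 + x ∈ T := by
  suffices h : ∀ j, j ≤ N → ∀ x ∈ I ^ (N - j + 1) • (⊤ : Submodule C (C ⊗[k] R)), 1 + x ∈ T from
    h N le_rfl x (by simpa using hx)
  intro j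
  induction j with
  | zero =>
    intro _ x hx
    simp only [tsub_zero, pow_succ, hI, Ideal.bot_mul, Submodule.bot_smul,
      Submodule.mem_bot] at hx
    simp [hx, T.one_mem]
  | succ j ih =>
    intro hj x hx
    obtain ⟨n, hn⟩ : ∃ n, N - (j + 1) = n := ⟨_, rfl⟩
    have hn' : N - j = n + 1 := by omega
    rw [hn] at hx
    replace ih := ih (by omega)
    rw [hn'] at ih
    suffices h : 1 + (0 + x) + 0 ∈ T by simpa using h
    refine (ideal_smul_top_induction b hb _ (Q := fun x => x ∈ I ^ (n + 1) •
        (⊤ : Submodule C (C ⊗[k] R)) ∧ ∀ z ∈ I ^ (n + 1) • (⊤ : Submodule C (C ⊗[k] R)),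
          (∀ y ∈ I ^ (n + 1 + 1) • (⊤ : Submodule C (C ⊗[k] R)), 1 + z + y ∈ T) →
          ∀ y ∈ I ^ (n + 1 + 1) • (⊤ : Submodule C (C ⊗[k] R)), 1 + (z + x) + y ∈ T)
      ⟨zero_mem _, by simp⟩ ?_ ?_ hx).2 0 (zero_mem _) (by simpa using ih) 0 (zero_mem _)
    · rintro x x' ⟨hx, h⟩ ⟨hx', h'⟩
      refine ⟨add_mem hx hx', fun z hz hzT => ?_⟩
      rw [← add_assoc z x x']
      exact h' _ (add_mem hz hx) (h z hz hzT)
    · intro c hc g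
      have hcg : c ⊗ₜ[k] b g ∈ I ^ (n + 1) • (⊤ : Submodule C (C ⊗[k] R)) := by
        rw [← mul_one c, ← smul_eq_mul, ← TensorProduct.smul_tmul']
        exact Submodule.smul_mem_smul hc Submodule.mem_top
      refine ⟨hcg, fun z hz hzT y hy => ?_⟩
      have hcI : c ∈ I := Ideal.pow_le_self n.succ_ne_zero hc
      have hnil : IsNilpotent (c ⊗ₜ[k] b g) := by
        refine ⟨N, ?_⟩
        have : c ^ N = 0 := by
          rw [← Ideal.mem_bot, ← hI]; exact Ideal.pow_mem_pow hcI N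
        rw [Algebra.TensorProduct.tmul_pow, this, TensorProduct.zero_tmul]
      obtain ⟨u, hu⟩ := hnil.isUnit_one_add
      have key : 1 + (z + c ⊗ₜ[k] b g) + y
          = (1 + c ⊗ₜ[k] b g) * (1 + z + ↑u⁻¹ * (y - c ⊗ₜ[k] b g * z)) := by
        rw [mul_add, ← hu, Units.mul_inv_cancel_left, hu]
        noncomm_ring
      rw [key]
      refine T.mul_mem (hT c hcI g) (hzT _ ?_)
      refine mul_mem_pow_smul_top (m := 0) I (by omega) (by simp)
        (sub_mem hy (mul_mem_pow_smul_top I (by omega) hcg hz))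

end Nilpotent

end PolyLaw

namespace LaurentPolynomial

/-- The linear map `p(X) ↦ T ^ d * p(T⁻¹)`. -/
noncomputable def reflection (C : Type) [CommRing C] (d : ℕ) :
    Polynomial C →ₗ[C] LaurentPolynomial C :=
  LinearMap.mulLeft C (T (d : ℤ)) ∘ₗ
    ((invert (R := C)).toAlgHom.comp Polynomial.toLaurentAlg).toLinearMap

theorem reflection_monomial (C : Type) [CommRing C] (d n : ℕ) (c : C) :
    reflection C d (Polynomial.monomial n c) = c • T ((d : ℤ) - n) := by
  rw [← Polynomial.C_mul_X_pow_eq_monomial]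
  rw [smul_eq_C_mul, T_sub, mul_left_comm]
  simp [reflection, -T_mul]

theorem trunc_smul {C : Type} [CommRing C] (c : C) (p : LaurentPolynomial C) :
    trunc (c • p) = c • trunc p := by
  induction p using LaurentPolynomial.induction_on' with
  | add p q hp hq => simp [smul_add, hp, hq]
  | C_mul_T n a =>
    rw [smul_eq_C_mul, ← mul_assoc, ← map_mul, trunc_C_mul_T, trunc_C_mul_T]
    split_ifs <;> simp [Polynomial.smul_monomial]

/-- `LaurentPolynomial.trunc` as a linear map. -/
noncomputable def truncLinearMap (C : Type) [CommRing C] :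
    LaurentPolynomial C →ₗ[C] Polynomial C where
  toFun := trunc
  map_add' := map_add _
  map_smul' := trunc_smul

theorem coeff_trunc_reflection {C : Type} [CommRing C] (d : ℕ) (p : Polynomial C) :
    (truncLinearMap C (reflection C d p)).coeff d = p.coeff 0 := by
  induction p using Polynomial.induction_on' with
  | add p q hp hq => simp [hp, hq]
  | monomial n c =>
    rw [reflection_monomial, smul_eq_C_mul]
    change (trunc _).coeff d = _
    rw [trunc_C_mul_T]
    split_ifs with h
    · rw [Polynomial.coeff_monomial, Polynomial.coeff_monomial]
      congr 1
      simp only [eq_iff_iff]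
      omega
    · rw [Polynomial.coeff_monomial, if_neg (by omega), Polynomial.coeff_zero]

end LaurentPolynomial

namespace PolyLaw

open LaurentPolynomial

variable {k R S S' : Type} [CommRing k] [Ring R] [Algebra k R] [Ring S] [Algebra k S]
  [Ring S'] [Algebra k S']

theorem IsHomogeneous.rTensor_toLaurent {D : PolyLaw k R S} {d : ℕ} (hD : D.IsHomogeneous d)
    {C : Type} [CommRing C] [Algebra k C] (x : C ⊗[k] R) :
    LinearMap.rTensor S (Polynomial.toLaurentAlg.restrictScalars k).toLinearMap
        (D.toFun (Polynomial C) (1 + (Polynomial.X : Polynomial C) •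
          LinearMap.rTensor R (Polynomial.CAlgHom (R := k) (A := C)).toLinearMap x))
      = LinearMap.rTensor S ((reflection C d).restrictScalars k)
        (D.toFun (Polynomial C) ((Polynomial.X : Polynomial C) • (1 : Polynomial C ⊗[k] R) +
          LinearMap.rTensor R (Polynomial.CAlgHom (R := k) (A := C)).toLinearMap x)) := by
  have hrefl : (reflection C d).restrictScalars k
      = LinearMap.mulLeft k (T (d : ℤ)) ∘ₗ (((invert (R := C)).toAlgHom.comp
          Polynomial.toLaurentAlg).restrictScalars k).toLinearMap := rfl
  have hmul (z : LaurentPolynomial C ⊗[k] S) :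
      LinearMap.rTensor S (LinearMap.mulLeft k (T (d : ℤ))) z
        = (T 1 : LaurentPolynomial C) ^ d • z := by
    rw [T_pow, mul_one]
    induction z with
    | zero => simp
    | tmul a m => simp [TensorProduct.smul_tmul']
    | add x y hx hy => simp [smul_add, hx, hy]
  rw [hrefl, LinearMap.rTensor_comp_apply, hmul, ← D.isCompat, ← D.isCompat, ← hD]
  congr 1
  simp only [map_add, rTensor_algHom_smul, rTensor_algHom_one, smul_add, smul_smul]
  have e1 : (T 1 : LaurentPolynomial C) * (((invert (R := C)).toAlgHom.comp
          Polynomial.toLaurentAlg).restrictScalars k) Polynomial.X = 1 := by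
    simp [← T_add, -T_mul]
  rw [e1, one_smul]
  have e2 : (Polynomial.toLaurentAlg.restrictScalars k) (Polynomial.X : Polynomial C) = T 1 := by
    simp
  rw [e2]
  congr 2
  rw [← LinearMap.rTensor_comp_apply, ← LinearMap.rTensor_comp_apply, ← AlgHom.comp_toLinearMap,
    ← AlgHom.comp_toLinearMap]
  congr 3
  ext c
  simp

end PolyLaw

namespace PolyLaw

open LaurentPolynomial

variable {k R S S' : Type} [CommRing k] [Ring R] [Algebra k R] [Ring S] [Algebra k S]
  [Ring S'] [Algebra k S']

theorem IsHomogeneous.toFun_one_sub {D : PolyLaw k R S} {d : ℕ} (hD : D.IsHomogeneous d)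
    {r : R} {a : ℕ → S}
    (ha : D.toFun (Polynomial k) ((Polynomial.X : Polynomial k) ⊗ₜ[k] (1 : R) - 1 ⊗ₜ[k] r)
      = ∑ i ∈ Finset.range (d + 1), ((-1) ^ i * Polynomial.X ^ (d - i)) ⊗ₜ[k] a i)
    {C : Type} [CommRing C] [Algebra k C] (c : C) :
    D.toFun C (1 - c ⊗ₜ[k] r) = ∑ i ∈ Finset.range (d + 1), ((-c) ^ i) ⊗ₜ[k] a i := by
  have hpoly : D.toFun (Polynomial k) (1 - (Polynomial.X : Polynomial k) ⊗ₜ[k] r)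
      = ∑ i ∈ Finset.range (d + 1), ((-Polynomial.X) ^ i) ⊗ₜ[k] a i := by
    have h := congrArg (LinearMap.rTensor S (truncLinearMap k))
      (hD.rTensor_toLaurent (-((1 : k) ⊗ₜ[k] r)))
    simp only [LinearMap.rTensor_tmul, map_neg, AlgHom.toLinearMap_apply, map_one, smul_neg,
      TensorProduct.smul_tmul', smul_eq_mul, mul_one, ← sub_eq_add_neg,
      Algebra.TensorProduct.one_def] at h
    have hleft : truncLinearMap k ∘ₗ (Polynomial.toLaurentAlg.restrictScalars k).toLinearMap
        = LinearMap.id := LinearMap.ext (leftInverse_trunc_toLaurent (R := k))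
    rw [← LinearMap.rTensor_comp_apply, hleft, LinearMap.rTensor_id, LinearMap.id_apply, ha] at h
    rw [Algebra.TensorProduct.one_def, h, map_sum, map_sum]
    refine Finset.sum_congr rfl fun i hi => ?_
    rw [LinearMap.rTensor_tmul, LinearMap.rTensor_tmul]
    congr 1
    have hi' : i ≤ d := Nat.lt_succ_iff.mp (Finset.mem_range.mp hi)
    have : ((-1) ^ i * Polynomial.X ^ (d - i) : Polynomial k)
        = (-1 : k) ^ i • Polynomial.monomial (d - i) 1 := by
      rw [Polynomial.smul_eq_C_mul, ← Polynomial.X_pow_eq_monomial]; simp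
    rw [this, map_smul, map_smul]
    change _ • trunc (reflection k d _) = _
    rw [reflection_monomial, Nat.cast_sub hi', sub_sub_cancel, smul_eq_C_mul, trunc_C_mul_T]
    simp [neg_pow (Polynomial.X : Polynomial k), ← Polynomial.X_pow_eq_monomial,
      Polynomial.smul_eq_C_mul]
  have h := D.isCompat (Polynomial k) C (Polynomial.aeval c)
    (1 - (Polynomial.X : Polynomial k) ⊗ₜ[k] r)
  rw [hpoly, map_sub, rTensor_algHom_one] at h
  simpa using h

theorem IsHomogeneous.coeff_zero_eq_one {D : PolyLaw k R S} {d : ℕ} (hD : D.IsHomogeneous d)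
    (hone : D.toFun k 1 = 1) {r : R} {a : ℕ → S}
    (ha : D.toFun (Polynomial k) ((Polynomial.X : Polynomial k) ⊗ₜ[k] (1 : R) - 1 ⊗ₜ[k] r)
      = ∑ i ∈ Finset.range (d + 1), ((-1) ^ i * Polynomial.X ^ (d - i)) ⊗ₜ[k] a i) :
    a 0 = 1 := by
  have h := congrArg (TensorProduct.lid k S) (hD.toFun_one_sub ha (0 : k))
  rw [TensorProduct.zero_tmul, sub_zero, hone, Finset.sum_range_succ'] at h
  simpa [Algebra.TensorProduct.one_def] using h.symm

/-- If a subalgebra contains the coefficients of all the `D (X - b g)`, where the submonoid `b G`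
spans `R`, then it contains all the values of the determinant `D`. -/
theorem toFun_mem_range_lTensor {G : Type} [Monoid G] (b : G →* R)
    (hb : Submodule.span k (Set.range b) = ⊤) (ι : S' →ₐ[k] S) {D : PolyLaw k R S} {d : ℕ}
    (hD : D.IsHomogeneous d) (hmul : D.IsMultiplicative) {a : G → ℕ → S}
    (ha : ∀ g, D.toFun (Polynomial k)
        ((Polynomial.X : Polynomial k) ⊗ₜ[k] (1 : R) - 1 ⊗ₜ[k] b g)
      = ∑ i ∈ Finset.range (d + 1), ((-1) ^ i * Polynomial.X ^ (d - i)) ⊗ₜ[k] a g i)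
    (hmem : ∀ g i, 1 ≤ i → i ≤ d → a g i ∈ ι.range)
    {C : Type} [CommRing C] [Algebra k C] (x : C ⊗[k] R) :
    D.toFun C x ∈ LinearMap.range (ι.toLinearMap.lTensor C) := by
  have hlin (C : Type) [CommRing C] [Algebra k C] (c : C) (g : G) :
      D.toFun C (1 + c ⊗ₜ[k] b g) ∈ LinearMap.range (ι.toLinearMap.lTensor C) := by
    rw [← neg_neg c, TensorProduct.neg_tmul, ← sub_eq_add_neg, hD.toFun_one_sub (ha g)]
    refine sum_mem fun i hi => ?_
    obtain ⟨s, hs⟩ : a g i ∈ ι.range := by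
      rcases Nat.eq_zero_or_pos i with rfl | hi'
      · rw [hD.coeff_zero_eq_one (hmul.1 k) (ha g)]; exact one_mem _
      · exact hmem g i hi' (Nat.lt_succ_iff.mp (Finset.mem_range.mp hi))
    exact ⟨_ ⊗ₜ[k] s, by rw [← hs]; rfl⟩
  let f : Polynomial C := Polynomial.X ^ (d + 1)
  have hf : f.Monic := Polynomial.monic_X_pow _
  let mk : Polynomial C →ₐ[k] AdjoinRoot f := (AdjoinRoot.mkₐ f).restrictScalars k
  let T : Submonoid (AdjoinRoot f ⊗[k] R) :=
    { carrier := {z | D.toFun _ z ∈ LinearMap.range (ι.toLinearMap.lTensor _)}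
      one_mem' := by
        rw [Set.mem_ofPred_eq, hmul.1]
        exact one_mem_range_lTensor ι
      mul_mem' := fun {x y} hx hy => by
        rw [Set.mem_ofPred_eq, hmul.2]
        exact mul_mem_range_lTensor ι hx hy }
  let incl := (Polynomial.CAlgHom (R := k) (A := C)).toLinearMap
  have hP : LinearMap.rTensor S mk.toLinearMap (D.toFun (Polynomial C)
      (1 + (Polynomial.X : Polynomial C) • LinearMap.rTensor R incl x))
        ∈ LinearMap.range (ι.toLinearMap.lTensor _) := by
    rw [← D.isCompat, map_add, rTensor_algHom_one, rTensor_algHom_smul]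
    refine one_add_mem_of_nilpotent b hb (Ideal.span {mk Polynomial.X}) (N := d + 1) ?_ T
      (fun c _ g => hlin _ c g)
      (Submodule.smul_mem_smul (Ideal.mem_span_singleton_self _) Submodule.mem_top)
    rw [Ideal.span_singleton_pow, ← map_pow, Ideal.span_singleton_eq_bot]
    exact AdjoinRoot.mk_self
  have hcoeff := rTensor_mem_range_lTensor ι.toLinearMap
    ((Polynomial.lcoeff C d ∘ₗ AdjoinRoot.modByMonicHom hf).restrictScalars k) hP
  rw [← LinearMap.rTensor_comp_apply] at hcoeff
  have h1 : (Polynomial.lcoeff C d ∘ₗ AdjoinRoot.modByMonicHom hf).restrictScalars k ∘ₗ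
      mk.toLinearMap = (Polynomial.lcoeff C d ∘ₗ truncLinearMap C).restrictScalars k ∘ₗ
        (Polynomial.toLaurentAlg.restrictScalars k).toLinearMap := by
    ext1 p
    change (AdjoinRoot.modByMonicHom hf (AdjoinRoot.mk f p)).coeff d
      = (trunc (Polynomial.toLaurent p)).coeff d
    rw [AdjoinRoot.modByMonicHom_mk, Polynomial.trunc_toLaurent]
    conv_rhs => rw [← Polynomial.modByMonic_add_div p f]
    rw [Polynomial.coeff_add, Polynomial.coeff_X_pow_mul', if_neg (by omega), add_zero]
  rw [h1, LinearMap.rTensor_comp_apply, hD.rTensor_toLaurent,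
    ← LinearMap.rTensor_comp_apply] at hcoeff
  have h2 : (Polynomial.lcoeff C d ∘ₗ truncLinearMap C).restrictScalars k ∘ₗ
      (reflection C d).restrictScalars k
      = ((Polynomial.aeval (0 : C)).restrictScalars k).toLinearMap := by
    ext1 p
    change (truncLinearMap C (reflection C d p)).coeff d = Polynomial.aeval 0 p
    rw [coeff_trunc_reflection, Polynomial.coeff_zero_eq_aeval_zero]
  rw [h2, ← D.isCompat, map_add, rTensor_algHom_smul] at hcoeff
  have h3 : ((Polynomial.aeval (0 : C)).restrictScalars k).comp
      (Polynomial.CAlgHom (R := k) (A := C)) = AlgHom.id k C := by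
    ext c; simp
  rw [← LinearMap.rTensor_comp_apply, ← AlgHom.comp_toLinearMap, h3] at hcoeff
  simpa using hcoeff

end PolyLaw

namespace PolyLaw

section Descent

variable {k M N N' : Type} [CommRing k] [AddCommGroup M] [Module k M] [AddCommGroup N]
  [Module k N] [AddCommGroup N'] [Module k N']

theorem lTensor_mvPolynomial_injective {ι : N' →ₗ[k] N} (hι : Function.Injective ι) (σ : Type) :
    Function.Injective (ι.lTensor (MvPolynomial σ k)) :=
  Module.Flat.lTensor_preserves_injective_linearMap ι hι

theorem basis_repr_rTensor {σ : Type} (b : Module.Basis σ k M) {C C' : Type} [CommRing C]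
    [Algebra k C] [CommRing C'] [Algebra k C'] (φ : C →ₐ[k] C') (x : C ⊗[k] M) (i : σ) :
    (Algebra.TensorProduct.basis C' b).repr (LinearMap.rTensor M φ.toLinearMap x) i
      = φ ((Algebra.TensorProduct.basis C b).repr x i) := by
  induction x with
  | zero => simp
  | tmul c m => simp
  | add x y hx hy => simp [hx, hy]

theorem sum_repr_tmul {σ : Type} (b : Module.Basis σ k M) {C : Type} [CommRing C]
    [Algebra k C] (x : C ⊗[k] M) :
    ∑ i ∈ ((Algebra.TensorProduct.basis C b).repr x).support,
      (Algebra.TensorProduct.basis C b).repr x i ⊗ₜ[k] b i = x := by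
  conv_rhs => rw [← (Algebra.TensorProduct.basis C b).linearCombination_repr x,
    Finsupp.linearCombination_apply, Finsupp.sum]
  exact Finset.sum_congr rfl fun i _ => by
    rw [Algebra.TensorProduct.basis_apply, TensorProduct.smul_tmul', smul_eq_mul, mul_one]

/-- A polynomial law on a free module with values in the image of an injective linear map factors
through it. -/
theorem exists_lTensor_comp_eq {σ : Type} (b : Module.Basis σ k M) {ι : N' →ₗ[k] N}
    (hι : Function.Injective ι) (D : PolyLaw k M N)
    (hD : ∀ (s : Finset σ), D.toFun (MvPolynomial σ k) (∑ i ∈ s, MvPolynomial.X i ⊗ₜ[k] b i)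
      ∈ LinearMap.range (ι.lTensor (MvPolynomial σ k))) :
    ∃ D' : PolyLaw k M N', ∀ (C : Type) [CommRing C] [Algebra k C] (x : C ⊗[k] M),
      ι.lTensor C (D'.toFun C x) = D.toFun C x := by
  classical
  choose F hF using hD
  let coord (C : Type) [CommRing C] [Algebra k C] (x : C ⊗[k] M) : σ →₀ C :=
    (Algebra.TensorProduct.basis C b).repr x
  have lcomm {C C' : Type} [CommRing C] [Algebra k C] [CommRing C'] [Algebra k C']
      (φ : C →ₐ[k] C') (z : C ⊗[k] N') : ι.lTensor C' (LinearMap.rTensor N' φ.toLinearMap z)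
        = LinearMap.rTensor N φ.toLinearMap (ι.lTensor C z) := by
    simp only [← LinearMap.comp_apply, LinearMap.rTensor_comp_lTensor,
      LinearMap.lTensor_comp_rTensor]
  have hres (s t : Finset σ) (hst : s ⊆ t) : LinearMap.rTensor N' (MvPolynomial.aeval (R := k)
      fun i => if i ∈ s then (MvPolynomial.X i : MvPolynomial σ k) else 0).toLinearMap (F t)
        = F s := by
    apply lTensor_mvPolynomial_injective hι σ
    rw [lcomm, hF, hF, ← D.isCompat, map_sum]
    congr 1
    simp only [LinearMap.rTensor_tmul, AlgHom.toLinearMap_apply, MvPolynomial.aeval_X,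
      TensorProduct.ite_tmul, Finset.sum_ite_mem]
    rw [Finset.inter_eq_right.mpr hst]
  have hsupp (C : Type) [CommRing C] [Algebra k C] (c : σ →₀ C) (t : Finset σ)
      (ht : c.support ⊆ t) :
      LinearMap.rTensor N' (MvPolynomial.aeval (R := k) c).toLinearMap (F t)
        = LinearMap.rTensor N' (MvPolynomial.aeval (R := k) c).toLinearMap (F c.support) := by
    rw [← hres _ _ ht, ← LinearMap.rTensor_comp_apply, ← AlgHom.comp_toLinearMap]
    congr 3
    ext i
    by_cases hi : c i = 0 <;> simp [hi]
  refine ⟨⟨fun C _ _ x => LinearMap.rTensor N'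
    (MvPolynomial.aeval (R := k) (coord C x)).toLinearMap (F (coord C x).support), ?_⟩, ?_⟩
  · intro C _ _ C' _ _ φ x
    have hcoord (i : σ) : coord C' (LinearMap.rTensor M φ.toLinearMap x) i = φ (coord C x i) :=
      basis_repr_rTensor b φ x i
    rw [← hsupp _ _ (coord C x).support, ← LinearMap.rTensor_comp_apply,
      ← AlgHom.comp_toLinearMap]
    · congr 3
      ext i
      simp [hcoord]
    · intro i
      simp only [Finsupp.mem_support_iff, hcoord]
      exact mt fun h => by rw [h, map_zero]
  · intro C _ _ x
    rw [lcomm, hF, ← D.isCompat, map_sum]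
    congr 1
    simp only [LinearMap.rTensor_tmul, AlgHom.toLinearMap_apply, MvPolynomial.aeval_X]
    exact sum_repr_tmul b x

theorem exists_rTensor_eq {C : Type} [CommRing C] [Algebra k C] (x : C ⊗[k] M) :
    ∃ y : MvPolynomial C k ⊗[k] M,
      LinearMap.rTensor M (MvPolynomial.aeval (R := k) (id : C → C)).toLinearMap y = x :=
  LinearMap.rTensor_surjective M (fun c => ⟨MvPolynomial.X c, by simp⟩) x

theorem IsHomogeneous.of_lTensor_comp_eq {ι : N' →ₗ[k] N} (hι : Function.Injective ι)
    {D : PolyLaw k M N} {D' : PolyLaw k M N'} {d : ℕ} (hD : D.IsHomogeneous d)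
    (h : ∀ (C : Type) [CommRing C] [Algebra k C] (x : C ⊗[k] M),
      ι.lTensor C (D'.toFun C x) = D.toFun C x) : D'.IsHomogeneous d := by
  intro C _ _ c x
  obtain ⟨y, rfl⟩ := exists_rTensor_eq x
  obtain ⟨p, rfl⟩ : ∃ p : MvPolynomial C k, MvPolynomial.aeval (id : C → C) p = c :=
    ⟨MvPolynomial.X c, by simp⟩
  rw [← rTensor_algHom_smul, D'.isCompat, D'.isCompat, ← map_pow, ← rTensor_algHom_smul]
  congr 1
  apply lTensor_mvPolynomial_injective hι C
  rw [h, hD, ← h]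
  exact (map_smul (TensorProduct.AlgebraTensorModule.lTensor (MvPolynomial C k)
    (MvPolynomial C k) ι) _ _).symm

theorem eq_of_lTensor_comp_eq {ι : N' →ₗ[k] N} (hι : Function.Injective ι)
    {D₁ D₂ : PolyLaw k M N'}
    (h : ∀ (C : Type) [CommRing C] [Algebra k C] (x : C ⊗[k] M),
      ι.lTensor C (D₁.toFun C x) = ι.lTensor C (D₂.toFun C x)) : D₁ = D₂ := by
  suffices h : @D₁.toFun = @D₂.toFun by
    cases D₁; cases D₂; congr
  funext C _ _ x
  obtain ⟨y, rfl⟩ := exists_rTensor_eq x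
  rw [D₁.isCompat, D₂.isCompat]
  congr 1
  exact lTensor_mvPolynomial_injective hι C (h _ y)

theorem IsMultiplicative.of_lTensor_comp_eq {R S S' : Type} [Ring R] [Algebra k R] [Ring S]
    [Algebra k S] [Ring S'] [Algebra k S'] {ι : S' →ₐ[k] S} (hι : Function.Injective ι)
    {D : PolyLaw k R S} {D' : PolyLaw k R S'} (hD : D.IsMultiplicative)
    (h : ∀ (C : Type) [CommRing C] [Algebra k C] (x : C ⊗[k] R),
      ι.toLinearMap.lTensor C (D'.toFun C x) = D.toFun C x) : D'.IsMultiplicative := by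
  have map_mul' {C C' T : Type} [CommRing C] [Algebra k C] [CommRing C'] [Algebra k C'] [Ring T]
      [Algebra k T] (φ : C →ₐ[k] C') (x y : C ⊗[k] T) : LinearMap.rTensor T φ.toLinearMap (x * y)
        = LinearMap.rTensor T φ.toLinearMap x * LinearMap.rTensor T φ.toLinearMap y :=
    map_mul (Algebra.TensorProduct.map φ (AlgHom.id k T)) x y
  refine ⟨fun C _ _ => ?_, fun C _ _ x y => ?_⟩
  · let φ : MvPolynomial C k →ₐ[k] C := MvPolynomial.aeval id
    rw [← rTensor_algHom_one φ, D'.isCompat, ← rTensor_algHom_one φ]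
    congr 1
    apply lTensor_mvPolynomial_injective (ι := ι.toLinearMap) hι C
    rw [h, hD.1]
    exact (map_one (Algebra.TensorProduct.map (AlgHom.id k (MvPolynomial C k)) ι)).symm
  · obtain ⟨x, rfl⟩ := exists_rTensor_eq x
    obtain ⟨y, rfl⟩ := exists_rTensor_eq y
    rw [← map_mul', D'.isCompat, D'.isCompat, D'.isCompat, ← map_mul']
    congr 1
    apply lTensor_mvPolynomial_injective (ι := ι.toLinearMap) hι C
    rw [h, hD.2, ← h, ← h]
    exact (map_mul (Algebra.TensorProduct.map (AlgHom.id k (MvPolynomial C k)) ι) _ _).symm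

end Descent

end PolyLaw

/-- Let `D` be a `d`-dimensional `A`-valued determinant on a monoid `G`,
with characteristic polynomial coefficients `Λ i g`, and let `B₀ ⊆ A` be the subring
generated by the `Λ i g`, `g ∈ G`, `1 ≤ i ≤ d`.  Then all the coefficients of
`D(g₁ t₁ + ⋯ + g_n t_n) ∈ A[t₁, …, t_n]` lie in `B₀`, and `D` factors through a unique
`B₀`-valued determinant of dimension `d` on `G`. -/
theorem det_factors_through_coeff_subring (G : Type) [Monoid G] (A : Type) [CommRing A]
    (d : ℕ)
    (D : PolyLaw ℤ (MonoidAlgebra ℤ G) A) (hhom : D.IsHomogeneous d)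
    (hmul : D.IsMultiplicative)
    (Λ : ℕ → G → A)
    (hΛ : ∀ g : G,
      D.toFun (Polynomial ℤ)
          ((Polynomial.X : Polynomial ℤ) ⊗ₜ[ℤ] (1 : MonoidAlgebra ℤ G)
            - (1 : Polynomial ℤ) ⊗ₜ[ℤ] (MonoidAlgebra.of ℤ G g))
        = ∑ i ∈ Finset.range (d + 1),
            ((-1 : Polynomial ℤ) ^ i * Polynomial.X ^ (d - i)) ⊗ₜ[ℤ] Λ i g) :
    (∀ (n : ℕ) (g : Fin n → G) (α : Fin n →₀ ℕ),
      TensorProduct.lid ℤ A (LinearMap.rTensor A (mvLcoeff α)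
        (D.toFun (MvPolynomial (Fin n) ℤ)
          (∑ i, MvPolynomial.X i ⊗ₜ[ℤ] MonoidAlgebra.of ℤ G (g i))))
        ∈ Subring.closure {a : A | ∃ (g : G) (i : ℕ), 1 ≤ i ∧ i ≤ d ∧ a = Λ i g}) ∧
    (∃! D' : PolyLaw ℤ (MonoidAlgebra ℤ G)
          (Subring.closure {a : A | ∃ (g : G) (i : ℕ), 1 ≤ i ∧ i ≤ d ∧ a = Λ i g}),
      (D'.IsHomogeneous d ∧ D'.IsMultiplicative) ∧
      ∀ (C : Type) [CommRing C] (x : C ⊗[ℤ] MonoidAlgebra ℤ G),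
        LinearMap.lTensor C
            ((Subring.closure
              {a : A | ∃ (g : G) (i : ℕ), 1 ≤ i ∧ i ≤ d ∧ a = Λ i g}).subtype.toAddMonoidHom.toIntLinearMap)
            (D'.toFun C x)
          = D.toFun C x) := by
  let B₀ := Subring.closure {a : A | ∃ (g : G) (i : ℕ), 1 ≤ i ∧ i ≤ d ∧ a = Λ i g}
  let ι : B₀ →ₐ[ℤ] A := B₀.subtype.toIntAlgHom
  have hι : Function.Injective ι := Subtype.val_injective
  have hspan : Submodule.span ℤ (Set.range (MonoidAlgebra.of ℤ G)) = ⊤ := by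
    rw [← (MonoidAlgebra.basis G ℤ).span_eq]
    congr 2
  have hrange := fun (C : Type) [CommRing C] [Algebra ℤ C] =>
    PolyLaw.toFun_mem_range_lTensor (C := C) (MonoidAlgebra.of ℤ G) hspan ι hhom hmul
      (a := fun g i => Λ i g) hΛ
      (fun g i h₁ h₂ => ⟨⟨Λ i g, Subring.subset_closure ⟨g, i, h₁, h₂, rfl⟩⟩, rfl⟩)
  refine ⟨fun n g α => ?_, ?_⟩
  · obtain ⟨w, hw⟩ := PolyLaw.rTensor_mem_range_lTensor ι.toLinearMap (mvLcoeff α)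
      (hrange (MvPolynomial (Fin n) ℤ) (∑ i, MvPolynomial.X i ⊗ₜ[ℤ] MonoidAlgebra.of ℤ G (g i)))
    rw [← hw]
    have hlid (z : ℤ ⊗[ℤ] B₀) : TensorProduct.lid ℤ A (ι.toLinearMap.lTensor ℤ z)
        = ι (TensorProduct.lid ℤ B₀ z) := by
      induction z with
      | zero => simp
      | tmul m s => simp
      | add x y hx hy => rw [map_add, map_add, hx, hy, map_add, map_add]
    rw [hlid]
    exact (TensorProduct.lid ℤ B₀ w).2
  · obtain ⟨D', hD'⟩ := PolyLaw.exists_lTensor_comp_eq (MonoidAlgebra.basis G ℤ)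
      (ι := ι.toLinearMap) hι D (fun s => hrange _ _)
    refine ⟨D', ⟨⟨hhom.of_lTensor_comp_eq hι hD', hmul.of_lTensor_comp_eq hι hD'⟩,
      fun C _ x => hD' C x⟩, ?_⟩
    rintro D'' ⟨-, hD''⟩
    refine PolyLaw.eq_of_lTensor_comp_eq (ι := ι.toLinearMap) hι fun C _ inst x => ?_
    obtain rfl := Subsingleton.elim inst (Ring.toIntAlgebra C)
    rw [hD' C x]
    exact hD'' C x
end

section
/- Let A be a commutative ring, d ≥ 1, R an A-algebra, S a nonzero A-algebra, and P : R → S a multiplicative A-polynomial law homogeneous of degree d. Then ker(P) = {r ∈ R : for every commutative A-algebra B and every r' ∈ R ⊗_A B, P_B(1 + rr') = 1} = {r ∈ R : for every commutative A-algebra B and every r' ∈ R ⊗_A B, P_B(1 + r'r) = 1}, and ker(P) is a proper two-sided ideal of R. -/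
open TensorProduct

namespace PolyLaw

open Polynomial

variable {A : Type} [CommRing A]

section Polynomial

variable {B : Type} [CommRing B] [Algebra A B] {M : Type} [AddCommGroup M] [Module A M]

/-- The `i`-th coefficient of a polynomial, as a map linear over the base ring `A`. -/
noncomputable def coeffLinear (A B : Type) [CommRing A] [CommRing B] [Algebra A B] (i : ℕ) :
    B[X] →ₗ[A] B :=
  (lcoeff B i).restrictScalars A

/-- The `i`-th monomial, as a map linear over the base ring `A`. -/
noncomputable def monomialLinear (A B : Type) [CommRing A] [CommRing B] [Algebra A B] (i : ℕ) :
    B →ₗ[A] B[X] :=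
  (monomial i).restrictScalars A

/-- The truncated polynomial ring `B[X] / (X ^ n)`. -/
abbrev TruncPoly (B : Type) [CommRing B] (n : ℕ) : Type :=
  B[X] ⧸ Ideal.span {(X : B[X]) ^ n}

/-- The projection `B[X] → B[X] / (X ^ n)`. -/
noncomputable abbrev toTruncPoly (A B : Type) [CommRing A] [CommRing B] [Algebra A B] (n : ℕ) :
    B[X] →ₐ[A] TruncPoly B n :=
  Ideal.Quotient.mkₐ A _

theorem isNilpotent_toTruncPoly_X (n : ℕ) : IsNilpotent (toTruncPoly A B n X) :=
  ⟨n, by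
    rw [← map_pow]
    exact Ideal.Quotient.eq_zero_iff_mem.2 (Ideal.mem_span_singleton_self _)⟩

/-- The `i`-th coefficient of a polynomial only depends on its class modulo `X ^ (i + 1)`. -/
theorem exists_comp_toTruncPoly_eq_coeffLinear (i : ℕ) :
    ∃ g : TruncPoly B (i + 1) →ₗ[A] B,
      g ∘ₗ (toTruncPoly A B (i + 1)).toLinearMap = coeffLinear A B i := by
  refine ⟨Submodule.liftQ ((Ideal.span {(X : B[X]) ^ (i + 1)}).restrictScalars A)
      (coeffLinear A B i) ?_ ∘ₗ
      (Submodule.Quotient.restrictScalarsEquiv A (Ideal.span {(X : B[X]) ^ (i + 1)})).symm, ?_⟩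
  · intro p hp
    rw [Submodule.restrictScalars_mem, Ideal.mem_span_singleton, X_pow_dvd_iff] at hp
    exact hp i i.lt_succ_self
  · ext p
    rfl

theorem exists_eq_sum_monomial_coeff (z : B[X] ⊗[A] M) :
    ∃ N : ℕ, ∀ n ≥ N, z = ∑ i ∈ Finset.range n,
      (monomialLinear A B i).rTensor M ((coeffLinear A B i).rTensor M z) := by
  induction z with
  | zero => exact ⟨0, fun n _ => by simp⟩
  | tmul p m =>
    refine ⟨p.natDegree + 1, fun n hn => ?_⟩
    conv_lhs => rw [as_sum_range' p n hn, sum_tmul]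
    rfl
  | add x y hx hy =>
    obtain ⟨N, hN⟩ := hx
    obtain ⟨N', hN'⟩ := hy
    refine ⟨max N N', fun n hn => ?_⟩
    simp only [map_add, Finset.sum_add_distrib]
    rw [← hN n (le_trans (le_max_left _ _) hn), ← hN' n (le_trans (le_max_right _ _) hn)]

/-- The family of base changes along `B[X] → B[X] / (X ^ n)` is jointly injective. -/
theorem eq_of_forall_rTensor_toTruncPoly_eq {z w : B[X] ⊗[A] M}
    (h : ∀ n, (toTruncPoly A B n).toLinearMap.rTensor M z =
      (toTruncPoly A B n).toLinearMap.rTensor M w) : z = w := by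
  have hcoeff (i : ℕ) :
      (coeffLinear A B i).rTensor M z = (coeffLinear A B i).rTensor M w := by
    obtain ⟨g, hg⟩ := exists_comp_toTruncPoly_eq_coeffLinear (A := A) (B := B) i
    rw [← hg, LinearMap.rTensor_comp_apply, LinearMap.rTensor_comp_apply, h]
  obtain ⟨N, hN⟩ := exists_eq_sum_monomial_coeff z
  obtain ⟨N', hN'⟩ := exists_eq_sum_monomial_coeff w
  rw [hN _ (le_max_left N N'), hN' _ (le_max_right N N')]
  simp only [hcoeff]

end Polynomial

section BaseChange

variable {B C M : Type} [CommRing B] [Algebra A B] [CommRing C] [Algebra A C]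
  [AddCommGroup M] [Module A M]

theorem rTensor_smul (φ : B →ₐ[A] C) (b : B) (x : B ⊗[A] M) :
    φ.toLinearMap.rTensor M (b • x) = φ b • φ.toLinearMap.rTensor M x := by
  induction x with
  | zero => simp
  | tmul c m => simp [smul_tmul']
  | add x y hx hy => simp only [smul_add, map_add, hx, hy]

theorem rTensor_rTensor_of_comp_eq_id (φ : B →ₐ[A] C) (ψ : C →ₐ[A] B)
    (h : ψ.comp φ = AlgHom.id A B) (x : B ⊗[A] M) :
    ψ.toLinearMap.rTensor M (φ.toLinearMap.rTensor M x) = x := by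
  rw [← LinearMap.rTensor_comp_apply, ← AlgHom.comp_toLinearMap, h, AlgHom.toLinearMap_id,
    LinearMap.rTensor_id, LinearMap.id_apply]

end BaseChange

/-- To show that `P (m + x) = P (m + y)`, it suffices to show `P (m + τ x) = P (m + τ y)` for every
nilpotent parameter `τ` after base change. -/
theorem toFun_eq_of_nilpotent {M N : Type} [AddCommGroup M] [Module A M] [AddCommGroup N]
    [Module A N] (P : PolyLaw A M N) {B : Type} [CommRing B] [Algebra A B] (m x y : B ⊗[A] M)
    (h : ∀ (C : Type) [CommRing C] [Algebra A C] (φ : B →ₐ[A] C) (τ : C), IsNilpotent τ →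
      P.toFun C (φ.toLinearMap.rTensor M m + τ • φ.toLinearMap.rTensor M x) =
        P.toFun C (φ.toLinearMap.rTensor M m + τ • φ.toLinearMap.rTensor M y)) :
    P.toFun B (m + x) = P.toFun B (m + y) := by
  let ι : B →ₐ[A] B[X] := (Algebra.ofId B B[X]).restrictScalars A
  let ε : B[X] →ₐ[A] B := (aeval (1 : B)).restrictScalars A
  have hε : ε.comp ι = AlgHom.id A B :=
    AlgHom.ext fun b => by
      change aeval (1 : B) (algebraMap B B[X] b) = b
      simp
  have hX : ε X = 1 := aeval_X 1
  have key : P.toFun B[X] (ι.toLinearMap.rTensor M m + (X : B[X]) • ι.toLinearMap.rTensor M x) =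
      P.toFun B[X] (ι.toLinearMap.rTensor M m + (X : B[X]) • ι.toLinearMap.rTensor M y) := by
    refine eq_of_forall_rTensor_toTruncPoly_eq fun n => ?_
    have := h _ ((toTruncPoly A B n).comp ι) _
      (isNilpotent_toTruncPoly_X (A := A) (B := B) n)
    simpa only [← P.isCompat, map_add, rTensor_smul, AlgHom.comp_toLinearMap,
      LinearMap.rTensor_comp_apply] using this
  have := congrArg (ε.toLinearMap.rTensor N) key
  simpa only [← P.isCompat, map_add, rTensor_smul, hX, one_smul,
    rTensor_rTensor_of_comp_eq_id (A := A) ι ε hε] using this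

section Algebra

variable {B C R S : Type} [CommRing B] [Algebra A B] [CommRing C] [Algebra A C]
  [Ring R] [Algebra A R] [Ring S] [Algebra A S]

theorem rTensor_one (φ : B →ₐ[A] C) : φ.toLinearMap.rTensor R (1 : B ⊗[A] R) = 1 := by
  simp [Algebra.TensorProduct.one_def]

theorem isUnit_one_add_smul {τ : C} (hτ : IsNilpotent τ) (y : C ⊗[A] R) : IsUnit (1 + τ • y) := by
  obtain ⟨n, hn⟩ := hτ
  exact IsNilpotent.isUnit_one_add ⟨n, by rw [_root_.smul_pow, hn, zero_smul]⟩

theorem mul_inv_cancel_add_mul (u : (B ⊗[A] R)ˣ) (m x : B ⊗[A] R) :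
    (m * ↑u⁻¹ + x) * u = m + x * u := by
  rw [add_mul, Units.inv_mul_cancel_right]

theorem mul_inv_mul_cancel_add (u : (B ⊗[A] R)ˣ) (m x : B ⊗[A] R) :
    u * (↑u⁻¹ * m + x) = m + u * x := by
  rw [mul_add, Units.mul_inv_cancel_left]

variable {P : PolyLaw A R S}

theorem add_mem_ker {x y : R} (hx : x ∈ P.ker) (hy : y ∈ P.ker) : x + y ∈ P.ker := by
  intro B _ _ b m
  rw [tmul_add, add_assoc, hx, hy]

theorem toFun_add_mul_unit (hmul : P.IsMultiplicative) {x : R} (hx : x ∈ P.ker) (b : B)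
    (m : B ⊗[A] R) (u : (B ⊗[A] R)ˣ) :
    P.toFun B (m + b ⊗ₜ[A] x * u) = P.toFun B m := by
  rw [← mul_inv_cancel_add_mul, hmul.2, add_comm, hx, ← hmul.2, Units.inv_mul_cancel_right]

theorem toFun_add_unit_mul (hmul : P.IsMultiplicative) {x : R} (hx : x ∈ P.ker) (b : B)
    (m : B ⊗[A] R) (u : (B ⊗[A] R)ˣ) :
    P.toFun B (m + u * b ⊗ₜ[A] x) = P.toFun B m := by
  rw [← mul_inv_mul_cancel_add, hmul.2, add_comm, hx, ← hmul.2, Units.mul_inv_cancel_left]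

theorem mem_ker_of_nilpotent {x : R}
    (h : ∀ (C : Type) [CommRing C] [Algebra A C] (c τ : C) (m : C ⊗[A] R), IsNilpotent τ →
      P.toFun C (m + (τ * c) ⊗ₜ[A] x) = P.toFun C m) : x ∈ P.ker := by
  intro B _ _ b m
  rw [add_comm]
  nth_rw 2 [← add_zero m]
  refine P.toFun_eq_of_nilpotent m _ _ fun C _ _ φ τ hτ => ?_
  simpa [smul_tmul'] using h C (φ b) τ _ hτ

theorem mul_mem_ker_right (hmul : P.IsMultiplicative) {x : R} (hx : x ∈ P.ker) (r : R) :
    x * r ∈ P.ker := by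
  refine mem_ker_of_nilpotent fun C _ _ c τ m hτ => ?_
  obtain ⟨u, hu⟩ := isUnit_one_add_smul hτ ((1 : C) ⊗ₜ[A] r)
  rw [← hx C c, ← toFun_add_mul_unit hmul hx c m u, hu]
  congr 1
  simp only [mul_add, mul_one, smul_tmul', smul_eq_mul, Algebra.TensorProduct.tmul_mul_tmul,
    mul_comm c]
  abel

theorem mul_mem_ker_left (hmul : P.IsMultiplicative) {x : R} (hx : x ∈ P.ker) (r : R) :
    r * x ∈ P.ker := by
  refine mem_ker_of_nilpotent fun C _ _ c τ m hτ => ?_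
  obtain ⟨u, hu⟩ := isUnit_one_add_smul hτ ((1 : C) ⊗ₜ[A] r)
  rw [← hx C c, ← toFun_add_unit_mul hmul hx c m u, hu]
  congr 1
  simp only [add_mul, one_mul, mul_one, smul_tmul', smul_eq_mul,
    Algebra.TensorProduct.tmul_mul_tmul]
  abel

theorem toFun_add_tmul_mul (hmul : P.IsMultiplicative) {x : R} (hx : x ∈ P.ker)
    (m y : B ⊗[A] R) : P.toFun B (m + (1 : B) ⊗ₜ[A] x * y) = P.toFun B m := by
  induction y generalizing m with
  | zero => rw [mul_zero, add_zero]
  | tmul b r =>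
    rw [Algebra.TensorProduct.tmul_mul_tmul, one_mul, add_comm]
    exact mul_mem_ker_right hmul hx r B b m
  | add y z hy hz => rw [mul_add, ← add_assoc, hz, hy]

theorem toFun_add_mul_tmul (hmul : P.IsMultiplicative) {x : R} (hx : x ∈ P.ker)
    (m y : B ⊗[A] R) : P.toFun B (m + y * (1 : B) ⊗ₜ[A] x) = P.toFun B m := by
  induction y generalizing m with
  | zero => rw [zero_mul, add_zero]
  | tmul b r =>
    rw [Algebra.TensorProduct.tmul_mul_tmul, mul_one, add_comm]
    exact mul_mem_ker_left hmul hx r B b m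
  | add y z hy hz => rw [add_mul, ← add_assoc, hz, hy]

/-- Membership in the kernel may be tested on translations of units. -/
theorem mem_ker_of_units {x : R}
    (h : ∀ (C : Type) [CommRing C] [Algebra A C] (c : C) (u : (C ⊗[A] R)ˣ),
      P.toFun C (u + c ⊗ₜ[A] x) = P.toFun C u) : x ∈ P.ker := by
  intro B _ _ b m
  have := P.toFun_eq_of_nilpotent 1 (m - 1 + b ⊗ₜ[A] x) (m - 1) fun C _ _ φ τ hτ => by
    obtain ⟨u, hu⟩ := isUnit_one_add_smul hτ (φ.toLinearMap.rTensor R (m - 1))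
    rw [rTensor_one, map_add, smul_add, ← add_assoc, ← hu, LinearMap.rTensor_tmul, smul_tmul']
    exact h C _ u
  rwa [← add_assoc, add_sub_cancel, add_comm] at this

theorem mem_ker_iff_forall_one_add_mul (hmul : P.IsMultiplicative) {x : R} :
    x ∈ P.ker ↔ ∀ (B : Type) [CommRing B] [Algebra A B] (y : B ⊗[A] R),
      P.toFun B (1 + ((1 : B) ⊗ₜ[A] x) * y) = 1 := by
  refine ⟨fun hx B _ _ y => by rw [toFun_add_tmul_mul hmul hx, hmul.1], fun h => ?_⟩
  refine mem_ker_of_units fun C _ _ c u => ?_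
  have hu : (u : C ⊗[A] R) + c ⊗ₜ[A] x = (1 + ((1 : C) ⊗ₜ[A] x) * (c • ↑u⁻¹)) * u := by
    rw [add_mul, one_mul, mul_smul_comm, smul_mul_assoc, Units.inv_mul_cancel_right, smul_tmul',
      smul_eq_mul, mul_one]
  rw [hu, hmul.2, h, one_mul]

theorem mem_ker_iff_forall_one_add_mul' (hmul : P.IsMultiplicative) {x : R} :
    x ∈ P.ker ↔ ∀ (B : Type) [CommRing B] [Algebra A B] (y : B ⊗[A] R),
      P.toFun B (1 + y * ((1 : B) ⊗ₜ[A] x)) = 1 := by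
  refine ⟨fun hx B _ _ y => by rw [toFun_add_mul_tmul hmul hx, hmul.1], fun h => ?_⟩
  refine mem_ker_of_units fun C _ _ c u => ?_
  have hu : (u : C ⊗[A] R) + c ⊗ₜ[A] x = u * (1 + (c • ↑u⁻¹) * ((1 : C) ⊗ₜ[A] x)) := by
    rw [mul_add, mul_one, smul_mul_assoc, mul_smul_comm, Units.mul_inv_cancel_left, smul_tmul',
      smul_eq_mul, mul_one]
  rw [hu, hmul.2, h, mul_one]

theorem one_notMem_ker [Nontrivial S] {d : ℕ} (hd : 1 ≤ d) (hhom : P.IsHomogeneous d)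
    (hmul : P.IsMultiplicative) : (1 : R) ∉ P.ker := by
  intro h
  have hzero : P.toFun A (0 : A ⊗[A] R) = 0 := by
    have := hhom A 0 0
    rwa [zero_smul, zero_pow (by lia), zero_smul] at this
  have hone := h A 1 0
  rw [add_zero, ← Algebra.TensorProduct.one_def, hmul.1, hzero] at hone
  have := congrArg (Algebra.TensorProduct.lid A S) hone
  rw [map_one, map_zero] at this
  exact one_ne_zero this

end Algebra

end PolyLaw

/-- Characterization of the kernel of a multiplicative homogeneous
polynomial law of degree `d ≥ 1` with values in a nonzero algebra `S` :
`ker(P) = {r | ∀ B, ∀ r', P(1 + r r') = 1} = {r | ∀ B, ∀ r', P(1 + r' r) = 1}`,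
and `ker(P)` is a proper two-sided ideal of `R`. -/
theorem ker_eq_and_isTwoSidedIdeal (A R S : Type) [CommRing A] [Ring R] [Algebra A R]
    [Ring S] [Algebra A S] [Nontrivial S] (d : ℕ) (hd : 1 ≤ d)
    (P : PolyLaw A R S) (hhom : P.IsHomogeneous d) (hmul : P.IsMultiplicative) :
    P.ker = {r : R | ∀ (B : Type) [CommRing B] [Algebra A B] (r' : B ⊗[A] R),
        P.toFun B (1 + ((1 : B) ⊗ₜ[A] r) * r') = 1} ∧
    P.ker = {r : R | ∀ (B : Type) [CommRing B] [Algebra A B] (r' : B ⊗[A] R),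
        P.toFun B (1 + r' * ((1 : B) ⊗ₜ[A] r)) = 1} ∧
    (0 : R) ∈ P.ker ∧
    (∀ x ∈ P.ker, ∀ y ∈ P.ker, x + y ∈ P.ker) ∧
    (∀ x ∈ P.ker, ∀ r : R, r * x ∈ P.ker ∧ x * r ∈ P.ker) ∧
    (1 : R) ∉ P.ker := by
  refine ⟨Set.ext fun r => PolyLaw.mem_ker_iff_forall_one_add_mul hmul,
    Set.ext fun r => PolyLaw.mem_ker_iff_forall_one_add_mul' hmul, fun B _ _ b m => ?_,
    fun x hx y hy => PolyLaw.add_mem_ker hx hy,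
    fun x hx r => ⟨PolyLaw.mul_mem_ker_left hmul hx r, PolyLaw.mul_mem_ker_right hmul hx r⟩,
    PolyLaw.one_notMem_ker hd hhom hmul⟩
  rw [tmul_zero, zero_add]
end

section
/- Let A be a commutative ring in which 2 is invertible, R an A-algebra, and T : R → A an A-linear map with T(1) = 2, T(xy) = T(yx) for all x, y ∈ R, satisfying the 2-dimensional pseudocharacter identity: T(x)T(y)T(z) − T(x)T(yz) − T(y)T(xz) − T(z)T(xy) + T(xyz) + T(xzy) = 0 for all x, y, z ∈ R. Set f(x,y) = T(x)T(y) − T(xy) and D(x) = f(x,x)/2 = (T(x)² − T(x²))/2. Then for all x, x', y, y' ∈ R one has f(xy, x'y') + f(xy', x'y) = f(x,x') f(y,y'); in particular D(1) = 1 and D(xy) = D(x)D(y) for all x, y ∈ R. -/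
variable {A R : Type} [CommRing A] [Ring R] [Algebra A R]

/-- `f(x, y) = T(x)T(y) − T(xy)`. -/
def pairF (T : R →ₗ[A] A) (x y : R) : A := T x * T y - T (x * y)

/-- `D(x) = f(x, x)/2 = (T(x)² − T(x²))/2`. -/
noncomputable def pairD [Invertible (2 : A)] (T : R →ₗ[A] A) (x : R) : A :=
  ⅟(2 : A) * pairF T x x

/-- Let `2` be invertible in `A` and let `T : R → A` be an `A`-linear map
with `T(1) = 2`, `T(xy) = T(yx)`, satisfying the `2`-dimensional pseudocharacter identity.
Then `f(xy, x'y') + f(xy', x'y) = f(x, x')f(y, y')` for all `x, x', y, y'`; in particular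
`D(1) = 1` and `D(xy) = D(x)D(y)` where `D(x) = f(x,x)/2`. -/
theorem pseudochar_dim_two_multiplicative (A R : Type) [CommRing A] [Ring R] [Algebra A R]
    [Invertible (2 : A)]
    (T : R →ₗ[A] A) (h1 : T 1 = 2) (hcomm : ∀ x y : R, T (x * y) = T (y * x))
    (hps : ∀ x y z : R,
      T x * T y * T z - T x * T (y * z) - T y * T (x * z) - T z * T (x * y)
        + T (x * y * z) + T (x * (z * y)) = 0) :
    (∀ x x' y y' : R,
      pairF T (x * y) (x' * y') + pairF T (x * y') (x' * y) = pairF T x x' * pairF T y y') ∧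
    pairD T (1 : R) = 1 ∧
    (∀ x y : R, pairD T (x * y) = pairD T x * pairD T y) := by
  have key : ∀ a c b d : R,
      pairF T (a * b) (c * d) + pairF T (a * d) (c * b) = pairF T a c * pairF T b d := by
    intro a c b d
    have e₁ := hps (a * b) c d
    have e₂ := hps (c * a) b d
    have e₃ := hps (a * d) b c
    have e₄ := hps a b d
    have r₁ := hcomm c (a * b)
    have r₂ := hcomm c (a * d)
    have r₃ := hcomm c (a * b * d)
    have r₄ := hcomm c (a * d * b)
    have r₅ := hcomm c a
    have r₆ := hcomm b c
    simp only [pairF, mul_assoc] at *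
    linear_combination -e₁ + e₂ - e₃ - T c * e₄ + T d * r₁ + T b * r₂ - r₃ - r₄
      - (T b * T d - T (b * d)) * r₅ - T (a * d) * r₆
  have two_mul_pairD : ∀ x : R, 2 * pairD T x = pairF T x x := fun x => by
    rw [pairD, mul_invOf_cancel_left']
  refine ⟨key, ?_, fun x y => ?_⟩
  · rw [pairD, pairF, mul_one, h1, show (2 : A) * 2 - 2 = 2 by norm_num, invOf_mul_self]
  · have h := key x x y y
    rw [← two_mul_pairD, ← two_mul_pairD, ← two_mul_pairD] at h
    linear_combination ⅟(2 : A) * ⅟(2 : A) * h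
      - (pairD T (x * y) - pairD T x * pairD T y) * (1 + 2 * ⅟(2 : A)) * invOf_mul_self (2 : A)
end

section
/- Let A be a commutative ring, S₁ and S₂ A-algebras, and B a nonzero commutative A-algebra whose only idempotents are 0 and 1. Then any multiplicative A-polynomial law P : S₁ × S₂ → B which is homogeneous of degree d is the product p₁p₂ of two unique multiplicative homogeneous A-polynomial laws p_i : S_i → B of degrees d_i with d₁ + d₂ = d, where (p₁p₂)_{B'}(x₁, x₂) = (p₁)_{B'}(x₁)·(p₂)_{B'}(x₂) for every commutative A-algebra B' and x_i ∈ S_i ⊗_A B'. -/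
open TensorProduct

namespace LinearMap

variable {A R S T : Type*} [CommRing A] [Ring R] [Algebra A R] [Ring S] [Algebra A S]
  [Ring T] [Algebra A T] (B : Type*) [CommRing B] [Algebra A B]

theorem lTensor_map_mul {f : S →ₗ[A] R} (hf : ∀ x y, f (x * y) = f x * f y) (x y : B ⊗[A] S) :
    lTensor B f (x * y) = lTensor B f x * lTensor B f y := by
  induction x with
  | zero => simp
  | add x₁ x₂ h₁ h₂ => simp only [add_mul, map_add, h₁, h₂]
  | tmul b s =>
    induction y with
    | zero => simp
    | add y₁ y₂ h₁ h₂ => simp only [mul_add, map_add, h₁, h₂]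
    | tmul c t => simp [hf]

theorem lTensor_mul_lTensor_eq_zero {f : S →ₗ[A] R} {g : T →ₗ[A] R} (h : ∀ x y, f x * g y = 0)
    (x : B ⊗[A] S) (y : B ⊗[A] T) : lTensor B f x * lTensor B g y = 0 := by
  induction x with
  | zero => simp
  | add x₁ x₂ h₁ h₂ => simp only [add_mul, map_add, h₁, h₂, add_zero]
  | tmul b s =>
    induction y with
    | zero => simp
    | add y₁ y₂ h₁ h₂ => simp only [mul_add, map_add, h₁, h₂, add_zero]
    | tmul c t => simp [h]

end LinearMap

/-- In a nontrivial ring whose only idempotents are `0` and `1`, a finitely supported family of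
orthogonal idempotents with sum `1` is concentrated in one index. -/
theorem Finsupp.exists_eq_single_of_orthogonal {ι B : Type*} [CommRing B] [Nontrivial B]
    (hconn : ∀ b : B, IsIdempotentElem b → b = 0 ∨ b = 1) (b : ι →₀ B)
    (hidem : ∀ i, b i * b i = b i) (horth : ∀ i j, i ≠ j → b i * b j = 0)
    (hsum : (b.sum fun _ x ↦ x) = 1) : ∃ i, b = Finsupp.single i 1 := by
  classical
  obtain ⟨i, hi⟩ : ∃ i, b i ≠ 0 := by
    by_contra! h
    rw [show b = 0 from Finsupp.ext h, Finsupp.sum_zero_index] at hsum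
    exact zero_ne_one hsum
  have hi1 : b i = 1 := (hconn _ (hidem i)).resolve_left hi
  refine ⟨i, Finsupp.ext fun j ↦ ?_⟩
  rcases eq_or_ne i j with rfl | hij
  · simpa using hi1
  · simpa [hi1, Finsupp.single_eq_of_ne' hij] using horth i j hij

namespace PolyLaw

variable {A : Type} [CommRing A]

@[ext]
theorem ext {M N : Type} [AddCommGroup M] [Module A M] [AddCommGroup N] [Module A N]
    {P Q : PolyLaw A M N}
    (h : ∀ (B : Type) [CommRing B] [Algebra A B] (x : B ⊗[A] M), P.toFun B x = Q.toFun B x) :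
    P = Q := by
  cases P
  cases Q
  congr
  funext B _ _ x
  exact h B x

section Homogeneity

variable {S B : Type} [Ring S] [Algebra A S] [CommRing B] [Algebra A B]

/-- The value of a polynomial law at scalars is given by a polynomial with coefficients in `B`. -/
theorem exists_toFun_smul_one_eq_sum (P : PolyLaw A S B) :
    ∃ b : ℕ →₀ B, ∀ (C : Type) [CommRing C] [Algebra A C] (c : C),
      P.toFun C (c • 1) = b.sum fun i x ↦ (c ^ i) ⊗ₜ[A] x := by
  obtain ⟨b, hb⟩ := TensorProduct.eq_repr_basis_left (Polynomial.basisMonomials A)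
    (P.toFun (Polynomial A) ((Polynomial.X : Polynomial A) • 1))
  refine ⟨b, fun C _ _ c ↦ ?_⟩
  have h := P.isCompat (Polynomial A) C (Polynomial.aeval c) ((Polynomial.X : Polynomial A) • 1)
  rw [← hb, map_finsuppSum] at h
  simpa [Algebra.TensorProduct.one_def, TensorProduct.smul_tmul'] using h

theorem IsMultiplicative.coeff_orthogonal {P : PolyLaw A S B} (hP : P.IsMultiplicative)
    {b : ℕ →₀ B}
    (hb : ∀ (C : Type) [CommRing C] [Algebra A C] (c : C),
      P.toFun C (c • 1) = b.sum fun i x ↦ (c ^ i) ⊗ₜ[A] x) (k l : ℕ) :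
    b k * b l = if k = l then b k else 0 := by
  classical
  let R := Polynomial (Polynomial A)
  let s : R := Polynomial.C Polynomial.X
  let t : R := Polynomial.X
  let ψ : R →ₗ[A] A :=
    Polynomial.lcoeff A k ∘ₗ (Polynomial.lcoeff (Polynomial A) l).restrictScalars A
  let θ : R ⊗[A] B →ₗ[A] B := (TensorProduct.lid A B).toLinearMap ∘ₗ LinearMap.rTensor B ψ
  have hψ (i j : ℕ) : ψ (s ^ i * t ^ j) = if k = i ∧ l = j then 1 else 0 := by
    change ((Polynomial.C Polynomial.X ^ i * Polynomial.X ^ j :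
      Polynomial (Polynomial A)).coeff l).coeff k = _
    rw [← Polynomial.C_pow, Polynomial.coeff_C_mul, Polynomial.coeff_X_pow]
    split_ifs <;> simp_all [Polynomial.coeff_X_pow]
  have hθ (i j : ℕ) (x : B) :
      θ ((s ^ i * t ^ j) ⊗ₜ[A] x) = if k = i ∧ l = j then x else 0 := by
    simp only [θ, LinearMap.comp_apply, LinearMap.rTensor_tmul, hψ]
    split_ifs <;> simp
  have h : P.toFun R ((s * t) • 1) = P.toFun R (s • 1) * P.toFun R (t • 1) := by
    rw [← hP.2, smul_mul_smul_comm, one_mul]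
  rw [hb, hb, hb] at h
  have h' := congrArg θ h
  simp only [Finsupp.sum, Finset.sum_mul_sum, Algebra.TensorProduct.tmul_mul_tmul, map_sum,
    mul_pow, hθ] at h'
  have hl : (∑ i ∈ b.support, if k = i ∧ l = i then b i else 0) = if k = l then b k else 0 := by
    rw [Finset.sum_eq_single k]
    · simp [eq_comm]
    · intro i _ hi
      simp [hi.symm]
    · intro hk
      simp [Finsupp.notMem_support_iff.mp hk]
  have hr : (∑ i ∈ b.support, ∑ j ∈ b.support, if k = i ∧ l = j then b i * b j else 0) =
      b k * b l := by
    rw [Finset.sum_eq_single k, Finset.sum_eq_single l]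
    · simp
    · intro j _ hj
      simp [hj.symm]
    · intro hl
      simp [Finsupp.notMem_support_iff.mp hl]
    · intro i _ hi
      simp [hi.symm]
    · intro hk
      simp [Finsupp.notMem_support_iff.mp hk]
  rw [← hr, ← h', hl]

/-- A multiplicative polynomial law with values in a connected algebra is homogeneous. -/
theorem IsMultiplicative.exists_isHomogeneous [Nontrivial B]
    (hconn : ∀ b : B, IsIdempotentElem b → b = 0 ∨ b = 1) {P : PolyLaw A S B}
    (hP : P.IsMultiplicative) : ∃ d, P.IsHomogeneous d := by
  obtain ⟨b, hb⟩ := P.exists_toFun_smul_one_eq_sum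
  have horth := hP.coeff_orthogonal hb
  have hsum : (b.sum fun _ x ↦ x) = 1 := by
    have h := congrArg (TensorProduct.lid A B) (hb A 1)
    rw [one_smul, hP.1, map_finsuppSum] at h
    simpa [Algebra.TensorProduct.one_def] using h.symm
  obtain ⟨d, rfl⟩ := b.exists_eq_single_of_orthogonal hconn (fun i ↦ by simp [horth])
    (fun i j hij ↦ by simp [horth, hij]) hsum
  refine ⟨d, fun C _ _ c x ↦ ?_⟩
  have h : P.toFun C (c • 1) = c ^ d • 1 := by
    rw [hb, Finsupp.sum_single_index (by simp), Algebra.TensorProduct.one_def,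
      TensorProduct.smul_tmul', smul_eq_mul, mul_one]
  rw [← one_mul x, ← smul_mul_assoc, hP.2, h, one_mul, smul_mul_assoc, one_mul]

theorem IsMultiplicative.degree_unique [Nontrivial B] {P : PolyLaw A S B}
    (hP : P.IsMultiplicative) {d e : ℕ} (hd : P.IsHomogeneous d) (he : P.IsHomogeneous e) :
    d = e := by
  have h := (hd (Polynomial A) Polynomial.X 1).symm.trans (he (Polynomial A) Polynomial.X 1)
  rw [hP.1, Algebra.TensorProduct.one_def, TensorProduct.smul_tmul',
    TensorProduct.smul_tmul'] at h
  have h' := congrArg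
    (TensorProduct.lid A B ∘ LinearMap.rTensor B (Polynomial.lcoeff A d)) h
  by_contra hne
  simp [Polynomial.coeff_X_pow, hne] at h'

end Homogeneity

section Product

variable {S T R B : Type} [Ring S] [Algebra A S] [Ring T] [Algebra A T] [Ring R] [Algebra A R]
  [Ring B] [Algebra A B]

/-- The polynomial law `x ↦ P (f x + g 1)`. -/
noncomputable def compAddOne (P : PolyLaw A R B) (f : S →ₗ[A] R) (g : T →ₗ[A] R) :
    PolyLaw A S B where
  toFun C _ _ x := P.toFun C (LinearMap.lTensor C f x + LinearMap.lTensor C g 1)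
  isCompat C _ _ D _ _ φ x := by
    rw [← P.isCompat, map_add]
    congr 2
    · rw [← LinearMap.comp_apply, ← LinearMap.comp_apply, LinearMap.lTensor_comp_rTensor,
        LinearMap.rTensor_comp_lTensor]
    · simp [Algebra.TensorProduct.one_def]

theorem IsMultiplicative.compAddOne {P : PolyLaw A R B} (hP : P.IsMultiplicative)
    {f : S →ₗ[A] R} {g : T →ₗ[A] R} (hf : ∀ x y, f (x * y) = f x * f y)
    (hg : ∀ x y, g (x * y) = g x * g y) (hfg : ∀ x y, f x * g y = 0) (hgf : ∀ x y, g x * f y = 0)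
    (hone : f 1 + g 1 = 1) : (P.compAddOne f g).IsMultiplicative := by
  refine ⟨fun C _ _ ↦ ?_, fun C _ _ x y ↦ ?_⟩
  · simp [PolyLaw.compAddOne, Algebra.TensorProduct.one_def, ← TensorProduct.tmul_add, hone,
      ← hP.1 C]
  · simp only [PolyLaw.compAddOne, ← hP.2, add_mul, mul_add,
      LinearMap.lTensor_mul_lTensor_eq_zero C hfg, LinearMap.lTensor_mul_lTensor_eq_zero C hgf,
      ← LinearMap.lTensor_map_mul C hf, ← LinearMap.lTensor_map_mul C hg, mul_one, add_zero,
      zero_add]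

theorem IsMultiplicative.toFun_add {P : PolyLaw A R B} (hP : P.IsMultiplicative)
    {f : S →ₗ[A] R} {g : T →ₗ[A] R} (hf : ∀ x y, f (x * y) = f x * f y)
    (hg : ∀ x y, g (x * y) = g x * g y) (hfg : ∀ x y, f x * g y = 0) (hgf : ∀ x y, g x * f y = 0)
    (C : Type) [CommRing C] [Algebra A C] (x : C ⊗[A] S) (y : C ⊗[A] T) :
    P.toFun C (LinearMap.lTensor C f x + LinearMap.lTensor C g y) =
      (P.compAddOne f g).toFun C x * (P.compAddOne g f).toFun C y := by
  simp only [PolyLaw.compAddOne, ← hP.2, add_mul, mul_add,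
    LinearMap.lTensor_mul_lTensor_eq_zero C hfg, LinearMap.lTensor_mul_lTensor_eq_zero C hgf,
    ← LinearMap.lTensor_map_mul C hf, ← LinearMap.lTensor_map_mul C hg, mul_one, one_mul, add_zero,
    zero_add]
  rw [add_comm]

end Product

end PolyLaw

/-- Over a nonzero commutative `A`-algebra `B` whose only idempotents are
`0` and `1`, any multiplicative homogeneous `A`-polynomial law `P : S₁ × S₂ → B` of degree
`d` is the product `p₁ p₂` of two unique multiplicative homogeneous laws `pᵢ : Sᵢ → B` of
degrees `dᵢ`, with `d₁ + d₂ = d`. -/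
theorem mult_law_on_product_decomposes (A S₁ S₂ B : Type) [CommRing A]
    [Ring S₁] [Algebra A S₁] [Ring S₂] [Algebra A S₂] [CommRing B] [Algebra A B]
    [Nontrivial B] (hconn : ∀ b : B, IsIdempotentElem b → b = 0 ∨ b = 1)
    (d : ℕ) (P : PolyLaw A (S₁ × S₂) B) (hhom : P.IsHomogeneous d)
    (hmul : P.IsMultiplicative) :
    ∃ (d₁ d₂ : ℕ) (p₁ : PolyLaw A S₁ B) (p₂ : PolyLaw A S₂ B),
      d₁ + d₂ = d ∧
      p₁.IsHomogeneous d₁ ∧ p₁.IsMultiplicative ∧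
      p₂.IsHomogeneous d₂ ∧ p₂.IsMultiplicative ∧
      (∀ (B' : Type) [CommRing B'] [Algebra A B'] (x₁ : B' ⊗[A] S₁) (x₂ : B' ⊗[A] S₂),
        P.toFun B' (LinearMap.lTensor B' (LinearMap.inl A S₁ S₂) x₁
                     + LinearMap.lTensor B' (LinearMap.inr A S₁ S₂) x₂)
          = p₁.toFun B' x₁ * p₂.toFun B' x₂) ∧
      ∀ (e₁ e₂ : ℕ) (q₁ : PolyLaw A S₁ B) (q₂ : PolyLaw A S₂ B),
        e₁ + e₂ = d →
        q₁.IsHomogeneous e₁ → q₁.IsMultiplicative →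
        q₂.IsHomogeneous e₂ → q₂.IsMultiplicative →
        (∀ (B' : Type) [CommRing B'] [Algebra A B'] (x₁ : B' ⊗[A] S₁) (x₂ : B' ⊗[A] S₂),
          P.toFun B' (LinearMap.lTensor B' (LinearMap.inl A S₁ S₂) x₁
                       + LinearMap.lTensor B' (LinearMap.inr A S₁ S₂) x₂)
            = q₁.toFun B' x₁ * q₂.toFun B' x₂) →
        e₁ = d₁ ∧ e₂ = d₂ ∧ q₁ = p₁ ∧ q₂ = p₂ := by
  have hinl (x y : S₁) : LinearMap.inl A S₁ S₂ (x * y) =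
      LinearMap.inl A S₁ S₂ x * LinearMap.inl A S₁ S₂ y := by simp
  have hinr (x y : S₂) : LinearMap.inr A S₁ S₂ (x * y) =
      LinearMap.inr A S₁ S₂ x * LinearMap.inr A S₁ S₂ y := by simp
  have hlr (x : S₁) (y : S₂) : LinearMap.inl A S₁ S₂ x * LinearMap.inr A S₁ S₂ y = 0 := by simp
  have hrl (x : S₂) (y : S₁) : LinearMap.inr A S₁ S₂ x * LinearMap.inl A S₁ S₂ y = 0 := by simp
  have hm₁ : (P.compAddOne (LinearMap.inl A S₁ S₂) (LinearMap.inr A S₁ S₂)).IsMultiplicative :=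
    hmul.compAddOne hinl hinr hlr hrl (by simp)
  have hm₂ : (P.compAddOne (LinearMap.inr A S₁ S₂) (LinearMap.inl A S₁ S₂)).IsMultiplicative :=
    hmul.compAddOne hinr hinl hrl hlr (by simp)
  obtain ⟨d₁, hd₁⟩ := hm₁.exists_isHomogeneous hconn
  obtain ⟨d₂, hd₂⟩ := hm₂.exists_isHomogeneous hconn
  have hfac := fun (C : Type) [CommRing C] [Algebra A C] ↦
    hmul.toFun_add hinl hinr hlr hrl C
  refine ⟨d₁, d₂, _, _, hmul.degree_unique (fun C _ _ c x ↦ ?_) hhom, hd₁, hm₁, hd₂, hm₂, hfac,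
    fun e₁ e₂ q₁ q₂ _ hh₁ hq₁ hh₂ hq₂ hq ↦ ?_⟩
  · have hx : x = LinearMap.lTensor C (LinearMap.inl A S₁ S₂)
          (LinearMap.lTensor C (LinearMap.fst A S₁ S₂) x) +
        LinearMap.lTensor C (LinearMap.inr A S₁ S₂)
          (LinearMap.lTensor C (LinearMap.snd A S₁ S₂) x) := by
      induction x with
      | zero => simp
      | tmul c s => simp [← TensorProduct.tmul_add]
      | add x y hx hy =>
        simp only [map_add]
        nth_rewrite 1 [hx, hy]
        abel
    generalize LinearMap.lTensor C (LinearMap.fst A S₁ S₂) x = x₁ at hx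
    generalize LinearMap.lTensor C (LinearMap.snd A S₁ S₂) x = x₂ at hx
    have hsmul (f : S₁ →ₗ[A] S₁ × S₂) (y : C ⊗[A] S₁) :
        c • LinearMap.lTensor C f y = LinearMap.lTensor C f (c • y) :=
      ((f.baseChange C).map_smul c y).symm
    have hsmul' (f : S₂ →ₗ[A] S₁ × S₂) (y : C ⊗[A] S₂) :
        c • LinearMap.lTensor C f y = LinearMap.lTensor C f (c • y) :=
      ((f.baseChange C).map_smul c y).symm
    rw [hx, smul_add, hsmul, hsmul', hfac, hfac, hd₁, hd₂, smul_mul_smul_comm, pow_add]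
  · have h₁ : q₁ = P.compAddOne (LinearMap.inl A S₁ S₂) (LinearMap.inr A S₁ S₂) := by
      ext C _ _ x
      simp [PolyLaw.compAddOne, hq, hq₂.1]
    have h₂ : q₂ = P.compAddOne (LinearMap.inr A S₁ S₂) (LinearMap.inl A S₁ S₂) := by
      ext C _ _ x
      simp [PolyLaw.compAddOne, add_comm (LinearMap.lTensor C (LinearMap.inr A S₁ S₂) x), hq,
        hq₁.1]
    subst h₁ h₂
    exact ⟨hm₁.degree_unique hh₁ hd₁, hm₂.degree_unique hh₂ hd₂, rfl, rfl⟩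
end

section
/- Let A be a commutative ring whose only idempotents are 0 and 1, R an A-algebra, and D : R → A a Cayley–Hamilton determinant of dimension d. For an idempotent e ∈ R, let r(e) be the dimension of the determinant D_e : eRe → A, x ↦ D(x + 1 − e). Then: e = 1 if and only if D(e) = 1, and e = 0 if and only if r(e) = 0. Moreover, if e₁, …, e_s is a family of nonzero pairwise orthogonal idempotents of R, then s ≤ d and Σ_{i=1}^{s} r(e_i) ≤ d, with equality if and only if e₁ + e₂ + … + e_s = 1. -/
open TensorProduct

namespace PolyLaw

/-- The characteristic polynomial `D(t - x) ∈ B[t]` of an element `x ∈ B ⊗[A] R` with respect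
to an `A`-valued polynomial law on `R`, computed via the base change `B → B[t]`. -/
noncomputable def charpoly {A R : Type} [CommRing A] [Ring R] [Algebra A R]
    (P : PolyLaw A R A) (B : Type) [CommRing B] [Algebra A B] (x : B ⊗[A] R) : Polynomial B :=
  TensorProduct.rid A (Polynomial B)
    (P.toFun (Polynomial B)
      ((Polynomial.X : Polynomial B) ⊗ₜ[A] (1 : R) -
        LinearMap.rTensor R (IsScalarTower.toAlgHom A B (Polynomial B)).toLinearMap x))

/-- The Cayley–Hamilton evaluation `χ(x) = x^d - Λ₁(x) x^{d-1} + ⋯ + (-1)^d Λ_d(x)`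
of an element `x ∈ B ⊗[A] R`, i.e. `∑_{k ≤ d} (coeff of t^k in D(t - x)) • x^k`. -/
noncomputable def chi {A R : Type} [CommRing A] [Ring R] [Algebra A R]
    (P : PolyLaw A R A) (d : ℕ) (B : Type) [CommRing B] [Algebra A B] (x : B ⊗[A] R) :
    B ⊗[A] R :=
  ∑ k ∈ Finset.range (d + 1), (P.charpoly B x).coeff k • x ^ k

/-- `D` is Cayley–Hamilton (of dimension `d`) if the polynomial law `χ` vanishes identically,
equivalently the Cayley-Hamilton ideal `CH(D)` is zero. -/
def IsCayleyHamilton {A R : Type} [CommRing A] [Ring R] [Algebra A R]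
    (P : PolyLaw A R A) (d : ℕ) : Prop :=
  ∀ (B : Type) [CommRing B] [Algebra A B] (x : B ⊗[A] R), P.chi d B x = 0

end PolyLaw

section Corner

variable {R : Type} [Ring R]

/-- The corner `eRe` of a ring `R` at an element `e` : the elements `x` with `e x e = x`. -/
def Corner (e : R) : Type := {x : R // e * x * e = x}

namespace Corner

variable (e : R)

instance : Zero (Corner e) := ⟨⟨0, by simp⟩⟩
instance : Add (Corner e) :=
  ⟨fun x y => ⟨x.1 + y.1, by rw [mul_add, add_mul, x.2, y.2]⟩⟩
instance : Neg (Corner e) := ⟨fun x => ⟨-x.1, by rw [mul_neg, neg_mul, x.2]⟩⟩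
instance : Sub (Corner e) :=
  ⟨fun x y => ⟨x.1 - y.1, by rw [mul_sub, sub_mul, x.2, y.2]⟩⟩
instance : SMul ℕ (Corner e) :=
  ⟨fun n x => ⟨n • x.1, by rw [mul_smul_comm, smul_mul_assoc, x.2]⟩⟩
instance : SMul ℤ (Corner e) :=
  ⟨fun n x => ⟨n • x.1, by rw [mul_smul_comm, smul_mul_assoc, x.2]⟩⟩

instance : AddCommGroup (Corner e) :=
  Function.Injective.addCommGroup (fun x : Corner e => x.1) Subtype.val_injective
    rfl (fun _ _ => rfl) (fun _ => rfl) (fun _ _ => rfl) (fun _ _ => rfl) (fun _ _ => rfl)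

theorem idem_mul_left {e x : R} (hee : e * e = e) (hx : e * x * e = x) : e * x = x := by
  conv_lhs => rw [← hx]
  rw [show e * (e * x * e) = e * e * x * e by noncomm_ring, hee, hx]

theorem idem_mul_right {e x : R} (hee : e * e = e) (hx : e * x * e = x) : x * e = x := by
  conv_lhs => rw [← hx]
  rw [show e * x * e * e = e * x * (e * e) by noncomm_ring, hee, hx]

variable [hf : Fact (IsIdempotentElem e)]

instance : One (Corner e) := ⟨⟨e, by rw [hf.out.eq, hf.out.eq]⟩⟩
instance : Mul (Corner e) :=
  ⟨fun x y => ⟨x.1 * y.1, by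
    rw [show e * (x.1 * y.1) * e = (e * x.1) * (y.1 * e) by noncomm_ring,
      idem_mul_left hf.out.eq x.2, idem_mul_right hf.out.eq y.2]⟩⟩

instance : Ring (Corner e) :=
  { (inferInstance : AddCommGroup (Corner e)) with
    mul := (· * ·)
    one := 1
    mul_assoc := fun x y z => Subtype.ext (mul_assoc x.1 y.1 z.1)
    one_mul := fun x => Subtype.ext (idem_mul_left hf.out.eq x.2)
    mul_one := fun x => Subtype.ext (idem_mul_right hf.out.eq x.2)
    left_distrib := fun x y z => Subtype.ext (mul_add x.1 y.1 z.1)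
    right_distrib := fun x y z => Subtype.ext (add_mul x.1 y.1 z.1)
    zero_mul := fun x => Subtype.ext (zero_mul x.1)
    mul_zero := fun x => Subtype.ext (mul_zero x.1) }

end Corner

variable {A : Type} [CommRing A] [Algebra A R]

instance (e : R) : SMul A (Corner e) :=
  ⟨fun a x => ⟨a • x.1, by rw [mul_smul_comm, smul_mul_assoc, x.2]⟩⟩

instance (e : R) : Module A (Corner e) :=
  Function.Injective.module A
    ({ toFun := fun x : Corner e => x.1, map_zero' := rfl, map_add' := fun _ _ => rfl } :
      Corner e →+ R)
    Subtype.val_injective (fun _ _ => rfl)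

instance (e : R) [Fact (IsIdempotentElem e)] : Algebra A (Corner e) :=
  Algebra.ofModule
    (fun a x y => Subtype.ext (smul_mul_assoc a x.1 y.1))
    (fun a x y => Subtype.ext (mul_smul_comm a x.1 y.1))

instance (e : R) [Fact (IsIdempotentElem e)] : Fact (IsIdempotentElem (1 - e)) :=
  ⟨(Fact.out (p := IsIdempotentElem e)).one_sub⟩

/-- The inclusion `eRe → R` as an `A`-linear map. -/
def cornerIncl (A : Type) [CommRing A] [Algebra A R] (e : R) : Corner e →ₗ[A] R where
  toFun x := x.1
  map_add' _ _ := rfl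
  map_smul' _ _ := rfl

end Corner

open TensorProduct

/-- `D_e : eRe → A, x ↦ D(x + 1 − e)` is homogeneous of degree `m`, i.e. the determinant
`D_e` has dimension `r(e) = m`. -/
def cornerDim {A R : Type} [CommRing A] [Ring R] [Algebra A R]
    (D : PolyLaw A R A) (e : R) (m : ℕ) : Prop :=
  ∀ (B : Type) [CommRing B] [Algebra A B] (b : B) (x : B ⊗[A] Corner e),
    D.toFun B (LinearMap.lTensor B (cornerIncl A e) (b • x) + 1 - (1 : B) ⊗ₜ[A] e)
      = b ^ m • D.toFun B (LinearMap.lTensor B (cornerIncl A e) x + 1 - (1 : B) ⊗ₜ[A] e)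

namespace PolyLaw

open Polynomial

variable {A R : Type} [CommRing A] [Ring R] [Algebra A R]

/-- The value `D(b e + 1 - e)` in `B`, for `e` in `R` and `b` in `B`. -/
noncomputable def scaleValue (D : PolyLaw A R A) (e : R) (B : Type) [CommRing B] [Algebra A B]
    (b : B) : B :=
  Algebra.TensorProduct.rid A B B (D.toFun B (b ⊗ₜ[A] e + (1 : B) ⊗ₜ[A] (1 - e)))

variable {D : PolyLaw A R A} {e : R}

theorem map_scaleValue {B C : Type} [CommRing B] [Algebra A B] [CommRing C] [Algebra A C]
    (φ : B →ₐ[A] C) (b : B) : φ (D.scaleValue e B b) = D.scaleValue e C (φ b) := by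
  have h := D.isCompat B C φ (b ⊗ₜ[A] e + (1 : B) ⊗ₜ[A] (1 - e))
  simp only [map_add, LinearMap.rTensor_tmul, AlgHom.toLinearMap_apply, map_one] at h
  rw [scaleValue, scaleValue, h]
  generalize D.toFun B _ = z
  induction z with
  | zero => simp
  | tmul x y => simp
  | add x y hx hy => simp only [map_add, hx, hy]

theorem scaleValue_one (hmul : D.IsMultiplicative) (B : Type) [CommRing B] [Algebra A B] :
    D.scaleValue e B 1 = 1 := by
  rw [scaleValue, ← tmul_add, add_sub_cancel, ← Algebra.TensorProduct.one_def, hmul.1, map_one]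

theorem scaleValue_zero_left (hmul : D.IsMultiplicative) {B : Type} [CommRing B] [Algebra A B]
    (b : B) : D.scaleValue 0 B b = 1 := by
  rw [scaleValue, tmul_zero, zero_add, sub_zero, ← Algebra.TensorProduct.one_def, hmul.1, map_one]

theorem scaleValue_one_left {d : ℕ} (hhom : D.IsHomogeneous d) (hmul : D.IsMultiplicative)
    {B : Type} [CommRing B] [Algebra A B] (b : B) : D.scaleValue 1 B b = b ^ d := by
  have h : b ⊗ₜ[A] (1 : R) = b • (1 : B ⊗[A] R) := by
    rw [Algebra.TensorProduct.one_def, smul_tmul', smul_eq_mul, mul_one]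
  rw [scaleValue, sub_self, tmul_zero, add_zero, h, hhom, hmul.1, map_smul, map_one, smul_eq_mul,
    mul_one]

theorem scaleValue_mul (hmul : D.IsMultiplicative) (he : IsIdempotentElem e) {B : Type}
    [CommRing B] [Algebra A B] (b c : B) :
    D.scaleValue e B (b * c) = D.scaleValue e B b * D.scaleValue e B c := by
  rw [scaleValue, scaleValue, scaleValue, ← map_mul, ← hmul.2]
  simp only [add_mul, mul_add, Algebra.TensorProduct.tmul_mul_tmul, he.eq, he.one_sub.eq,
    he.mul_one_sub_self, he.one_sub_mul_self, tmul_zero, mul_one, add_zero, zero_add]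

theorem scaleValue_add_left (hmul : D.IsMultiplicative) {f : R} (hef : e * f = 0) {B : Type}
    [CommRing B] [Algebra A B] (b : B) :
    D.scaleValue (e + f) B b = D.scaleValue e B b * D.scaleValue f B b := by
  rw [scaleValue, scaleValue, scaleValue, ← map_mul, ← hmul.2]
  congr 2
  have h₁ : e * (1 - f) = e := by rw [mul_sub, hef, mul_one, sub_zero]
  have h₂ : (1 - e) * f = f := by rw [sub_mul, hef, one_mul, sub_zero]
  have h₃ : (1 - e) * (1 - f) = 1 - (e + f) := by rw [mul_sub, h₂, mul_one, sub_sub]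
  simp only [add_mul, mul_add, Algebra.TensorProduct.tmul_mul_tmul, hef, h₁, h₂, h₃, tmul_add,
    tmul_zero, mul_one, one_mul]
  abel

theorem scaleValue_sum_left (hmul : D.IsMultiplicative) {ι : Type*} {E : ι → R}
    (hE : Pairwise fun i j => E i * E j = 0) {B : Type} [CommRing B] [Algebra A B] (b : B)
    (s : Finset ι) : D.scaleValue (∑ i ∈ s, E i) B b = ∏ i ∈ s, D.scaleValue (E i) B b := by
  classical
  induction s using Finset.induction_on with
  | empty => simp [scaleValue_zero_left hmul]
  | insert i s hi ih =>
    rw [Finset.sum_insert hi, Finset.prod_insert hi, ← ih, scaleValue_add_left hmul]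
    rw [Finset.mul_sum]
    exact Finset.sum_eq_zero fun j hj => hE (fun h => hi (h ▸ hj))

/-- The value at any `b` is obtained by specializing the one at the generic element `X`. -/
theorem scaleValue_eq_aeval {B : Type} [CommRing B] [Algebra A B] (b : B) :
    D.scaleValue e B b = aeval b (D.scaleValue e A[X] X) := by
  rw [map_scaleValue, aeval_X]

/-- Multiplicativity of `b ↦ D(b e + 1 - e)` makes the coefficients of `D(X e + 1 - e)`
orthogonal idempotents. -/
theorem coeff_scaleValue_mul_coeff (hmul : D.IsMultiplicative) (he : IsIdempotentElem e)
    (i j : ℕ) :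
    (D.scaleValue e A[X] X).coeff i * (D.scaleValue e A[X] X).coeff j =
      if i = j then (D.scaleValue e A[X] X).coeff j else 0 := by
  have h := scaleValue_mul hmul he (C (X : A[X])) X
  rw [scaleValue_eq_aeval (C (X : A[X]) * X), scaleValue_eq_aeval (C (X : A[X])),
    scaleValue_eq_aeval (X : A[X][X])] at h
  generalize D.scaleValue e A[X] X = g at h ⊢
  have haeval (q : A[X][X]) : aeval q g = (g.map C).comp q := by
    rw [comp, eval₂_map]
    rfl
  have hC : aeval (C (X : A[X])) g = C g := by
    rw [← CAlgHom_apply (R := A) (A := A[X]), aeval_algHom_apply, aeval_X_left_apply,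
      CAlgHom_apply]
  rw [hC, haeval, haeval, comp_X] at h
  have hcoeff := congrArg (fun q : A[X][X] => (q.coeff j).coeff i) h
  simp only [comp_C_mul_X_coeff, coeff_C_mul, coeff_map, coeff_mul_C, coeff_X_pow,
    mul_ite, mul_one, mul_zero] at hcoeff
  exact hcoeff.symm

/-- Over a connected ring, `D(b e + 1 - e)` is a power of `b` for every idempotent `e`. -/
theorem exists_scaleValue_eq_pow [Nontrivial A]
    (hconn : ∀ a : A, IsIdempotentElem a → a = 0 ∨ a = 1) (hmul : D.IsMultiplicative)
    (he : IsIdempotentElem e) : ∃ m, D.scaleValue e A[X] X = X ^ m := by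
  have horth := coeff_scaleValue_mul_coeff hmul he
  have hne : D.scaleValue e A[X] X ≠ 0 := fun h => by
    have h₁ := scaleValue_eq_aeval (D := D) (e := e) (1 : A)
    rw [scaleValue_one hmul, h, map_zero] at h₁
    exact one_ne_zero h₁
  generalize D.scaleValue e A[X] X = g at horth hne ⊢
  obtain ⟨m, hm⟩ : ∃ m, g.coeff m ≠ 0 := by
    by_contra! h
    exact hne (Polynomial.ext h)
  have hm₁ : g.coeff m = 1 := (hconn _ ((horth m m).trans (if_pos rfl))).resolve_left hm
  refine ⟨m, Polynomial.ext fun j => ?_⟩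
  have h := horth m j
  rw [hm₁, one_mul] at h
  rw [coeff_X_pow]
  split_ifs with hj
  · rw [hj, hm₁]
  · rw [h, if_neg (Ne.symm hj)]

theorem scaleValue_eq_pow {m : ℕ} (hm : D.scaleValue e A[X] X = X ^ m) {B : Type} [CommRing B]
    [Algebra A B] (b : B) : D.scaleValue e B b = b ^ m := by
  rw [scaleValue_eq_aeval, hm, map_pow, aeval_X]

theorem scaleValue_eq_pow_of_cornerDim (hmul : D.IsMultiplicative) (he : IsIdempotentElem e)
    {m : ℕ} (h : cornerDim D e m) : D.scaleValue e A[X] X = X ^ m := by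
  let u : Corner e := ⟨e, by rw [he.eq, he.eq]⟩
  have hcoeff := h A[X] X (1 ⊗ₜ[A] u)
  have hincl (b : A[X]) : LinearMap.lTensor A[X] (cornerIncl A e) (b ⊗ₜ[A] u) + 1 - 1 ⊗ₜ[A] e =
      b ⊗ₜ[A] e + 1 ⊗ₜ[A] (1 - e) := by
    rw [LinearMap.lTensor_tmul, tmul_sub, ← Algebra.TensorProduct.one_def, add_sub_assoc]
    rfl
  rw [smul_tmul', smul_eq_mul, mul_one, hincl, hincl] at hcoeff
  have h₁ := scaleValue_one (e := e) hmul A[X]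
  rw [scaleValue] at h₁ ⊢
  rw [hcoeff, map_smul, h₁, smul_eq_mul, mul_one]

theorem charpoly_tmul (hmul : D.IsMultiplicative) (he : IsIdempotentElem e) :
    D.charpoly A (1 ⊗ₜ[A] e) =
      D.scaleValue (1 - e) A[X] X * D.scaleValue e A[X] (X - 1) := by
  rw [scaleValue, scaleValue, ← map_mul, ← hmul.2, charpoly]
  have h : (X : A[X]) ⊗ₜ[A] (1 : R) - LinearMap.rTensor R
      (IsScalarTower.toAlgHom A A A[X]).toLinearMap ((1 : A) ⊗ₜ[A] e) =
      (X ⊗ₜ[A] (1 - e) + 1 ⊗ₜ[A] (1 - (1 - e))) * ((X - 1) ⊗ₜ[A] e + 1 ⊗ₜ[A] (1 - e)) := by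
    simp only [add_mul, mul_add, Algebra.TensorProduct.tmul_mul_tmul, sub_sub_cancel, he.eq,
      he.one_sub.eq, he.mul_one_sub_self, he.one_sub_mul_self, tmul_zero, mul_one, one_mul,
      add_zero, zero_add, LinearMap.rTensor_tmul, AlgHom.toLinearMap_apply, map_one]
    simp only [tmul_sub, sub_tmul]
    abel
  rw [h]
  rfl

/-- For a Cayley–Hamilton determinant, an idempotent of rank zero vanishes: its characteristic
polynomial is `X ^ d`, so it is nilpotent. -/
theorem eq_zero_of_scaleValue_eq_one {d : ℕ} (hhom : D.IsHomogeneous d)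
    (hmul : D.IsMultiplicative) (hCH : D.IsCayleyHamilton d) (he : IsIdempotentElem e)
    (h : D.scaleValue e A[X] X = 1) : e = 0 := by
  have hone : ∀ b : A[X], D.scaleValue e A[X] b = 1 := fun b => by
    rw [scaleValue_eq_pow (m := 0) (by rw [h, pow_zero]), pow_zero]
  have hc : D.charpoly A (1 ⊗ₜ[A] e) = X ^ d := by
    rw [charpoly_tmul hmul he, hone, mul_one, ← scaleValue_one_left hhom hmul,
      ← add_sub_cancel e 1, scaleValue_add_left hmul he.mul_one_sub_self, hone, one_mul,
      add_sub_cancel]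
  have hchi := hCH A (1 ⊗ₜ[A] e)
  simp only [chi, hc, coeff_X_pow, ite_smul, one_smul, zero_smul, Finset.sum_ite_eq',
    Finset.mem_range, Nat.lt_succ_self, if_true, Algebra.TensorProduct.tmul_pow, one_pow] at hchi
  have hed : e ^ d = 0 := by simpa using congrArg (TensorProduct.lid A R) hchi
  rcases Nat.eq_zero_or_pos d with rfl | hd
  · rw [pow_zero] at hed
    rw [← mul_one e, hed, mul_zero]
  · rwa [he.pow_eq hd.ne'] at hed

theorem ground_eq_scaleValue : D.ground e = D.scaleValue (1 - e) A 0 := by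
  rw [ground, scaleValue, zero_tmul, zero_add, sub_sub_cancel]
  generalize D.toFun A _ = z
  induction z with
  | zero => simp
  | tmul x y => simp [mul_comm]
  | add x y hx hy => simp only [map_add, hx, hy]

theorem eq_zero_iff_of_scaleValue_eq_pow [Nontrivial A] {d : ℕ} (hhom : D.IsHomogeneous d)
    (hmul : D.IsMultiplicative) (hCH : D.IsCayleyHamilton d) (he : IsIdempotentElem e) {m : ℕ}
    (hm : D.scaleValue e A[X] X = X ^ m) : e = 0 ↔ m = 0 := by
  refine ⟨?_, ?_⟩
  · rintro rfl
    rw [scaleValue_zero_left hmul] at hm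
    simpa using (congrArg natDegree hm).symm
  · rintro rfl
    exact eq_zero_of_scaleValue_eq_one hhom hmul hCH he (by rw [hm, pow_zero])

theorem eq_one_iff_ground_eq_one [Nontrivial A]
    (hconn : ∀ a : A, IsIdempotentElem a → a = 0 ∨ a = 1) {d : ℕ} (hhom : D.IsHomogeneous d)
    (hmul : D.IsMultiplicative) (hCH : D.IsCayleyHamilton d) (he : IsIdempotentElem e) :
    e = 1 ↔ D.ground e = 1 := by
  obtain ⟨m, hm⟩ := exists_scaleValue_eq_pow hconn hmul he.one_sub
  rw [ground_eq_scaleValue, scaleValue_eq_pow hm, eq_comm, ← sub_eq_zero,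
    eq_zero_iff_of_scaleValue_eq_pow hhom hmul hCH he.one_sub hm]
  rcases eq_or_ne m 0 with rfl | h0
  · simp
  · simp [h0]

/-- Ranks of pairwise orthogonal idempotents add up to at most `d`, with equality exactly when
the idempotents sum to `1`. -/
theorem sum_rank_le [Nontrivial A]
    (hconn : ∀ a : A, IsIdempotentElem a → a = 0 ∨ a = 1) {d : ℕ} (hhom : D.IsHomogeneous d)
    (hmul : D.IsMultiplicative) (hCH : D.IsCayleyHamilton d) {ι : Type*} [Fintype ι] {E : ι → R}
    (hE : OrthogonalIdempotents E) {r : ι → ℕ}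
    (hr : ∀ i, D.scaleValue (E i) A[X] X = X ^ r i) :
    ∑ i, r i ≤ d ∧ (∑ i, r i = d ↔ ∑ i, E i = 1) := by
  have hidem : IsIdempotentElem (1 - ∑ i, E i) := hE.isIdempotentElem_sum.one_sub
  obtain ⟨m, hm⟩ := exists_scaleValue_eq_pow hconn hmul hidem
  have hd : ∑ i, r i + m = d := by
    have h := scaleValue_one_left hhom hmul (X : A[X])
    rw [← add_sub_cancel (∑ i, E i) 1,
      scaleValue_add_left hmul hE.isIdempotentElem_sum.mul_one_sub_self,
      scaleValue_sum_left hmul hE.ortho, hm, Finset.prod_congr rfl fun i _ => hr i,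
      Finset.prod_pow_eq_pow_sum, ← pow_add] at h
    simpa using congrArg natDegree h
  have h0 := eq_zero_iff_of_scaleValue_eq_pow hhom hmul hCH hidem hm
  rw [sub_eq_zero, eq_comm] at h0
  exact ⟨by omega, by rw [h0]; omega⟩

end PolyLaw

/-- Let `A` be a connected commutative ring and `D : R → A` a
Cayley–Hamilton determinant of dimension `d`.  For an idempotent `e`, with `r(e)` the
dimension of `D_e : eRe → A`: `e = 1 ↔ D(e) = 1`, `e = 0 ↔ r(e) = 0`; and any family of
`s` nonzero pairwise orthogonal idempotents satisfies `s ≤ d` and `∑ r(eᵢ) ≤ d`, with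
equality iff `∑ eᵢ = 1`. -/
theorem cayleyHamilton_idempotents (A R : Type) [CommRing A] [Ring R] [Algebra A R]
    [Nontrivial A] (hconn : ∀ a : A, IsIdempotentElem a → a = 0 ∨ a = 1)
    (d : ℕ) (D : PolyLaw A R A) (hhom : D.IsHomogeneous d) (hmul : D.IsMultiplicative)
    (hCH : D.IsCayleyHamilton d) :
    (∀ e : R, IsIdempotentElem e → (e = 1 ↔ D.ground e = 1)) ∧
    (∀ e : R, IsIdempotentElem e → ∀ m : ℕ, cornerDim D e m → (e = 0 ↔ m = 0)) ∧
    (∀ (s : ℕ) (E : Fin s → R),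
      (∀ i, IsIdempotentElem (E i)) → (∀ i, E i ≠ 0) →
      (∀ i j, i ≠ j → E i * E j = 0) →
      s ≤ d ∧
      ∀ r : Fin s → ℕ, (∀ i, cornerDim D (E i) (r i)) →
        (∑ i, r i) ≤ d ∧ ((∑ i, r i) = d ↔ (∑ i, E i) = 1)) := by
  refine ⟨fun e he => PolyLaw.eq_one_iff_ground_eq_one hconn hhom hmul hCH he,
    fun e he m hm => PolyLaw.eq_zero_iff_of_scaleValue_eq_pow hhom hmul hCH he
      (PolyLaw.scaleValue_eq_pow_of_cornerDim hmul he hm), fun s E hE hE0 horth => ?_⟩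
  have hO : OrthogonalIdempotents E := ⟨hE, fun i j hij => horth i j hij⟩
  refine ⟨?_, fun r hr => PolyLaw.sum_rank_le hconn hhom hmul hCH hO fun i =>
    PolyLaw.scaleValue_eq_pow_of_cornerDim hmul (hE i) (hr i)⟩
  choose r hr using fun i => PolyLaw.exists_scaleValue_eq_pow hconn hmul (hE i)
  have hpos : ∀ i, 1 ≤ r i := fun i => Nat.one_le_iff_ne_zero.2 fun h =>
    hE0 i ((PolyLaw.eq_zero_iff_of_scaleValue_eq_pow hhom hmul hCH (hE i) (hr i)).2 h)
  calc s = ∑ _i : Fin s, 1 := by simp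
    _ ≤ ∑ i, r i := Finset.sum_le_sum fun i _ => hpos i
    _ ≤ d := (PolyLaw.sum_rank_le hconn hhom hmul hCH hO hr).1
end

section
/- Let k be a field, R a k-algebra, and D : R → k a Cayley–Hamilton determinant of dimension d. Then ker(D) equals the Jacobson radical Rad(R) of R. -/
open TensorProduct

namespace PolyLaw

variable {k R : Type} [Field k] [Ring R] [Algebra k R]

/-- The base change `B ⊗[k] R → C ⊗[k] R` along `φ : B → C`, as a homomorphism of algebras. -/
noncomputable def extend (R : Type) [Ring R] [Algebra k R] {B C : Type} [CommRing B] [Algebra k B]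
    [CommRing C] [Algebra k C] (φ : B →ₐ[k] C) : B ⊗[k] R →ₐ[k] C ⊗[k] R :=
  Algebra.TensorProduct.map φ (AlgHom.id k R)

@[simp]
theorem extend_tmul {B C : Type} [CommRing B] [Algebra k B]
    [CommRing C] [Algebra k C] (φ : B →ₐ[k] C) (b : B) (r : R) :
    extend R φ (b ⊗ₜ r) = φ b ⊗ₜ r := rfl

theorem extend_eq_rTensor {B C : Type} [CommRing B] [Algebra k B]
    [CommRing C] [Algebra k C] (φ : B →ₐ[k] C) (x : B ⊗[k] R) :
    extend R φ x = LinearMap.rTensor R φ.toLinearMap x := rfl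

theorem extend_comp {B C E : Type} [CommRing B] [Algebra k B] [CommRing C] [Algebra k C]
    [CommRing E] [Algebra k E] (ψ : C →ₐ[k] E) (φ : B →ₐ[k] C) (x : B ⊗[k] R) :
    extend R ψ (extend R φ x) = extend R (ψ.comp φ) x := by
  induction x with
  | zero => simp
  | tmul b r => simp
  | add x y hx hy => simp [hx, hy]

theorem extend_id {B : Type} [CommRing B] [Algebra k B] (x : B ⊗[k] R) :
    extend R (AlgHom.id k B) x = x := by
  induction x with
  | zero => simp
  | tmul b r => simp
  | add x y hx hy => simp [hx, hy]

theorem smul_one_tmul_one {B : Type} [CommRing B] [Algebra k B] (b : B) :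
    b • (1 : B ⊗[k] R) = b ⊗ₜ 1 := by
  rw [Algebra.TensorProduct.one_def, TensorProduct.smul_tmul', smul_eq_mul, mul_one]

/-- The value in `B` of a `k`-valued polynomial law at an element of `B ⊗[k] R`. -/
noncomputable def value (D : PolyLaw k R k) (B : Type) [CommRing B] [Algebra k B]
    (x : B ⊗[k] R) : B :=
  TensorProduct.rid k B (D.toFun B x)

theorem value_extend (D : PolyLaw k R k) {B C : Type} [CommRing B] [Algebra k B]
    [CommRing C] [Algebra k C] (φ : B →ₐ[k] C) (x : B ⊗[k] R) :
    D.value C (extend R φ x) = φ (D.value B x) := by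
  rw [value, extend_eq_rTensor, D.isCompat, value]
  generalize D.toFun B x = y
  induction y with
  | zero => simp
  | tmul b r => simp
  | add x y hx hy => simp [hx, hy]

theorem IsMultiplicative.value_one {D : PolyLaw k R k} (hmul : D.IsMultiplicative)
    (B : Type) [CommRing B] [Algebra k B] : D.value B 1 = 1 := by
  rw [value, hmul.1 B, Algebra.TensorProduct.one_def, TensorProduct.rid_tmul, one_smul]

theorem IsMultiplicative.value_mul {D : PolyLaw k R k} (hmul : D.IsMultiplicative)
    {B : Type} [CommRing B] [Algebra k B] (x y : B ⊗[k] R) :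
    D.value B (x * y) = D.value B x * D.value B y := by
  rw [value, hmul.2 B]
  exact map_mul (Algebra.TensorProduct.rid k k B) _ _

theorem IsHomogeneous.value_smul {D : PolyLaw k R k} {d : ℕ} (hhom : D.IsHomogeneous d)
    {B : Type} [CommRing B] [Algebra k B] (b : B) (x : B ⊗[k] R) :
    D.value B (b • x) = b ^ d * D.value B x := by
  rw [value, hhom B, value]
  exact map_smul (Algebra.TensorProduct.rid k B B) (b ^ d) (D.toFun B x)

theorem IsMultiplicative.isUnit_value {D : PolyLaw k R k} (hmul : D.IsMultiplicative)
    {B : Type} [CommRing B] [Algebra k B] {v x : B ⊗[k] R} (h : v * x = 1) :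
    IsUnit (D.value B x) :=
  .of_mul_eq_one (D.value B v) (by rw [mul_comm, ← hmul.value_mul, h, hmul.value_one])

theorem mem_ker_iff {D : PolyLaw k R k} {x : R} :
    x ∈ D.ker ↔ ∀ (B : Type) [CommRing B] [Algebra k B] (b : B) (m : B ⊗[k] R),
      D.value B (b ⊗ₜ x + m) = D.value B m := by
  simp only [value, (TensorProduct.rid k _).injective.eq_iff]
  rfl

theorem charpoly_eq_value (D : PolyLaw k R k) (B : Type) [CommRing B] [Algebra k B]
    (x : B ⊗[k] R) :
    D.charpoly B x = D.value (Polynomial B) ((Polynomial.X : Polynomial B) ⊗ₜ 1 -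
      extend R (IsScalarTower.toAlgHom k B (Polynomial B)) x) := rfl

theorem charpoly_coeff_zero (D : PolyLaw k R k) {B : Type} [CommRing B] [Algebra k B]
    (x : B ⊗[k] R) : (D.charpoly B x).coeff 0 = D.value B (-x) := by
  have h := D.value_extend ((Polynomial.aeval (0 : B)).restrictScalars k)
    ((Polynomial.X : Polynomial B) ⊗ₜ 1 -
      extend R (IsScalarTower.toAlgHom k B (Polynomial B)) x)
  rw [← charpoly_eq_value, map_sub, extend_comp] at h
  have hid : ((Polynomial.aeval (0 : B)).restrictScalars k).comp
      (IsScalarTower.toAlgHom k B (Polynomial B)) = AlgHom.id k B := by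
    ext b; simp
  rw [hid, extend_id] at h
  simpa [Polynomial.coeff_zero_eq_aeval_zero] using h.symm

/-- Under a Cayley–Hamilton determinant, an element with invertible determinant is invertible. -/
theorem IsCayleyHamilton.isUnit_of_isUnit_value {D : PolyLaw k R k} {d : ℕ}
    (hCH : D.IsCayleyHamilton d) (hhom : D.IsHomogeneous d)
    {B : Type} [CommRing B] [Algebra k B] {z : B ⊗[k] R} (hz : IsUnit (D.value B z)) :
    IsUnit z := by
  obtain ⟨u, hu⟩ : IsUnit ((D.charpoly B z).coeff 0) := by
    rw [charpoly_coeff_zero, ← neg_one_smul B, hhom.value_smul]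
    exact ((isUnit_neg_one).pow d).mul hz
  have h := hCH B z
  rw [chi, Finset.sum_range_succ', pow_zero, ← hu] at h
  set a := ∑ i ∈ Finset.range d, (D.charpoly B z).coeff (i + 1) • z ^ i
  have h1 : z * a = -((u : B) • 1) := by
    rw [← eq_neg_iff_add_eq_zero] at h
    rw [← h, Finset.mul_sum]
    exact Finset.sum_congr rfl fun i _ => by rw [mul_smul_comm, pow_succ']
  have h2 : a * z = -((u : B) • 1) := by
    rw [← eq_neg_iff_add_eq_zero] at h
    rw [← h, Finset.sum_mul]
    exact Finset.sum_congr rfl fun i _ => by rw [smul_mul_assoc, pow_succ]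
  refine ⟨⟨z, -((↑u⁻¹ : B) • a), ?_, ?_⟩, rfl⟩
  · rw [mul_neg, mul_smul_comm, h1, smul_neg, neg_neg, smul_smul, Units.inv_mul, one_smul]
  · rw [neg_mul, smul_mul_assoc, h2, smul_neg, neg_neg, smul_smul, Units.inv_mul, one_smul]

theorem value_X_add_ne_zero {D : PolyLaw k R k} {d : ℕ} (hhom : D.IsHomogeneous d)
    (hmul : D.IsMultiplicative) {B : Type} [CommRing B] [IsDomain B] [Algebra k B]
    (m : B ⊗[k] R) :
    D.value (Polynomial B) ((Polynomial.X : Polynomial B) ⊗ₜ 1 +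
      extend R (IsScalarTower.toAlgHom k B (Polynomial B)) m) ≠ 0 := by
  intro h0
  let F := FractionRing (Polynomial B)
  let ι : Polynomial B →ₐ[k] F := IsScalarTower.toAlgHom k (Polynomial B) F
  let i : B →ₐ[k] Polynomial B := IsScalarTower.toAlgHom k B (Polynomial B)
  have hι : Function.Injective ι := IsFractionRing.injective (Polynomial B) F
  let s : F := ι Polynomial.X
  have hs : s ≠ 0 := (map_ne_zero_iff ι hι).2 Polynomial.X_ne_zero
  let ψ : Polynomial B →ₐ[k] F := (Polynomial.aeval (R := B) s⁻¹).restrictScalars k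
  have hψi : ψ.comp i = ι.comp i := by
    ext b
    simp [ψ, i, ι, IsScalarTower.algebraMap_apply B (Polynomial B) F]
  have h1 := D.value_extend ψ ((Polynomial.X : Polynomial B) ⊗ₜ 1 + extend R i m)
  rw [h0, map_zero, map_add, extend_comp, hψi, extend_tmul,
    show ψ Polynomial.X = s⁻¹ by simp [ψ]] at h1
  have h2 : D.value F (extend R ι (1 + (Polynomial.X : Polynomial B) • extend R i m)) = 0 := by
    have : extend R ι (1 + (Polynomial.X : Polynomial B) • extend R i m) =
        s • (s⁻¹ ⊗ₜ 1 + extend R (ι.comp i) m) := by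
      rw [smul_add, TensorProduct.smul_tmul', smul_eq_mul, mul_inv_cancel₀ hs, map_add, map_one,
        ← extend_comp, Algebra.TensorProduct.one_def]
      congr 1
      generalize extend R i m = y
      induction y with
      | zero => simp
      | tmul b r => simp [TensorProduct.smul_tmul', s]
      | add x y hx hy => simp [hx, hy]
    rw [this, hhom.value_smul, h1, mul_zero]
  rw [value_extend, map_eq_zero_iff ι hι] at h2
  let e : Polynomial B →ₐ[k] B := (Polynomial.aeval (R := B) 0).restrictScalars k
  have h3 := D.value_extend e (1 + (Polynomial.X : Polynomial B) • extend R i m)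
  have h4 : extend R e (1 + (Polynomial.X : Polynomial B) • extend R i m) = 1 := by
    rw [map_add, map_one, add_eq_left]
    generalize extend R i m = y
    induction y with
    | zero => simp
    | tmul b r => simp [TensorProduct.smul_tmul', e]
    | add x y hx hy => simp [hx, hy]
  rw [h2, h4, map_zero, hmul.value_one] at h3
  exact one_ne_zero h3

/-- A generic translate of `m` becomes invertible over the field of rational functions. -/
theorem IsCayleyHamilton.isUnit_X_add {D : PolyLaw k R k} {d : ℕ}
    (hCH : D.IsCayleyHamilton d) (hhom : D.IsHomogeneous d)
    (hmul : D.IsMultiplicative) {B : Type} [CommRing B] [IsDomain B] [Algebra k B]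
    (m : B ⊗[k] R) :
    IsUnit (extend R (IsScalarTower.toAlgHom k (Polynomial B) (FractionRing (Polynomial B)))
      ((Polynomial.X : Polynomial B) ⊗ₜ 1 +
        extend R (IsScalarTower.toAlgHom k B (Polynomial B)) m)) := by
  apply hCH.isUnit_of_isUnit_value hhom
  rw [value_extend, isUnit_iff_ne_zero]
  exact (map_ne_zero_iff _ (IsFractionRing.injective (Polynomial B) _)).2
    (value_X_add_ne_zero hhom hmul m)

/-- The kernel of a Cayley–Hamilton determinant is stable under left multiplication, tested on
points of domains. -/
theorem IsCayleyHamilton.value_add_of_mem_ker {D : PolyLaw k R k} {d : ℕ}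
    (hCH : D.IsCayleyHamilton d) (hhom : D.IsHomogeneous d)
    (hmul : D.IsMultiplicative) {B : Type} [CommRing B] [IsDomain B] [Algebra k B]
    {x : R} (hx : x ∈ D.ker) (r : R) (b : B) (m : B ⊗[k] R) :
    D.value B (b ⊗ₜ (r * x) + m) = D.value B m := by
  rw [mem_ker_iff] at hx
  let F := FractionRing (Polynomial B)
  let ι : Polynomial B →ₐ[k] F := IsScalarTower.toAlgHom k (Polynomial B) F
  let i : B →ₐ[k] Polynomial B := IsScalarTower.toAlgHom k B (Polynomial B)
  let j : B →ₐ[k] F := ι.comp i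
  have hj : Function.Injective j :=
    (IsFractionRing.injective (Polynomial B) F).comp Polynomial.C_injective
  obtain ⟨(u : (F ⊗[k] R)ˣ), hu⟩ := hCH.isUnit_X_add hhom hmul ((1 : B) ⊗ₜ[k] r)
  have hu' : (u : F ⊗[k] R) = ι Polynomial.X ⊗ₜ 1 + 1 ⊗ₜ r := by
    rw [hu, map_add, extend_tmul, extend_tmul, extend_tmul, map_one, map_one]
  have key (n : F ⊗[k] R) (c : F) :
      D.value F ((u : F ⊗[k] R) * (c ⊗ₜ x) + n) = D.value F n := by
    have h1 : (u : F ⊗[k] R) * (c ⊗ₜ x) + n =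
        (u : F ⊗[k] R) * (c ⊗ₜ x + ((u⁻¹ : (F ⊗[k] R)ˣ) : F ⊗[k] R) * n) := by
      rw [mul_add, Units.mul_inv_cancel_left]
    rw [h1, hmul.value_mul, hx, ← hmul.value_mul, Units.mul_inv_cancel_left]
  apply hj
  rw [← value_extend, ← value_extend, map_add, extend_tmul]
  have h2 := key (extend R j m - (ι Polynomial.X * j b) ⊗ₜ x) (j b)
  have h3 : (u : F ⊗[k] R) * (j b ⊗ₜ x) + (extend R j m - (ι Polynomial.X * j b) ⊗ₜ x) =
      j b ⊗ₜ (r * x) + extend R j m := by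
    rw [hu', add_mul, Algebra.TensorProduct.tmul_mul_tmul, Algebra.TensorProduct.tmul_mul_tmul,
      one_mul, one_mul]
    abel
  rw [h3, sub_eq_neg_add, ← TensorProduct.neg_tmul, hx] at h2
  exact h2

theorem IsCayleyHamilton.pow_eq_zero_of_mem_ker {D : PolyLaw k R k} {d : ℕ}
    (hCH : D.IsCayleyHamilton d) (hhom : D.IsHomogeneous d)
    (hmul : D.IsMultiplicative) {x : R} (hx : x ∈ D.ker) (r : R) : (r * x) ^ d = 0 := by
  have hchar : D.charpoly k (1 ⊗ₜ (r * x)) = Polynomial.X ^ d := by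
    rw [charpoly_eq_value, extend_tmul, sub_eq_neg_add, ← TensorProduct.neg_tmul,
      hCH.value_add_of_mem_ker hhom hmul hx, ← smul_one_tmul_one, hhom.value_smul,
      hmul.value_one, mul_one]
  have h := hCH k (1 ⊗ₜ (r * x))
  rw [chi, hchar, Finset.sum_eq_single_of_mem d (by simp)
    (fun i _ hi => by rw [Polynomial.coeff_X_pow, if_neg hi, zero_smul]),
    Polynomial.coeff_X_pow_self, one_smul, Algebra.TensorProduct.tmul_pow, one_pow] at h
  simpa using congrArg (TensorProduct.lid k R) h

theorem IsCayleyHamilton.ker_subset_jacobson {D : PolyLaw k R k} {d : ℕ}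
    (hCH : D.IsCayleyHamilton d) (hhom : D.IsHomogeneous d)
    (hmul : D.IsMultiplicative) {x : R} (hx : x ∈ D.ker) : x ∈ Ring.jacobson R := by
  rw [← Ideal.jacobson_bot, Ideal.mem_jacobson_iff]
  intro y
  obtain ⟨u, hu⟩ := IsNilpotent.isUnit_one_add
    ⟨d, hCH.pow_eq_zero_of_mem_ker hhom hmul hx y⟩
  refine ⟨↑u⁻¹, ?_⟩
  have h : (↑u⁻¹ : R) * (1 + y * x) = 1 := by rw [← hu, Units.inv_mul]
  rw [Ideal.mem_bot, sub_eq_zero, ← h]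
  noncomm_ring

/-- Adding to `1` an element of the left ideal generated by the Jacobson radical produces a left
invertible element after a finite base change. -/
theorem exists_mul_one_add_eq_one {B : Type} [CommRing B] [Algebra k B] [Module.Finite k B]
    {ι : Type} [Fintype ι] (c : ι → B) {x : ι → R} (hx : ∀ i, x i ∈ Ring.jacobson R) :
    ∃ v : B ⊗[k] R, v * (1 + ∑ i, c i ⊗ₜ x i) = 1 := by
  suffices h : ∃ v : R ⊗[k] B, v * (1 + ∑ i, x i ⊗ₜ c i) = 1 by
    obtain ⟨v, hv⟩ := h
    refine ⟨Algebra.TensorProduct.comm k R B v, ?_⟩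
    simpa using congrArg (Algebra.TensorProduct.comm k R B) hv
  let N : Submodule R (R ⊗[k] B) :=
    LinearMap.range (LinearMap.mulRight R (1 + ∑ i, x i ⊗ₜ c i : R ⊗[k] B))
  suffices hN : N = ⊤ by
    have h1 : (1 : R ⊗[k] B) ∈ N := hN ▸ Submodule.mem_top
    exact h1
  have hsum (m : R ⊗[k] B) (i : ι) :
      m * (x i ⊗ₜ c i) ∈ Ring.jacobson R • (⊤ : Submodule R (R ⊗[k] B)) := by
    induction m with
    | zero => simp
    | tmul r b =>
      have : (r ⊗ₜ b * x i ⊗ₜ c i : R ⊗[k] B) = (r * x i) • (1 ⊗ₜ (b * c i)) := by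
        simp [TensorProduct.smul_tmul']
      rw [this]
      exact Submodule.smul_mem_smul (Ideal.mul_mem_left _ r (hx i)) Submodule.mem_top
    | add m n hm hn => rw [add_mul]; exact add_mem hm hn
  have htop : (⊤ : Submodule R ((R ⊗[k] B) ⧸ N)) = ⊥ := by
    apply Submodule.FG.eq_bot_of_le_jacobson_smul Module.Finite.fg_top
    rintro q -
    obtain ⟨m, rfl⟩ := N.mkQ_surjective q
    have h1 : N.mkQ m = N.mkQ (-∑ i, m * (x i ⊗ₜ c i)) := by
      rw [← sub_eq_zero, ← map_sub, Submodule.mkQ_apply, Submodule.Quotient.mk_eq_zero]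
      exact ⟨m, by simp [mul_add, Finset.mul_sum]⟩
    rw [h1]
    have h2 : -∑ i, m * (x i ⊗ₜ c i) ∈ Ring.jacobson R • (⊤ : Submodule R (R ⊗[k] B)) :=
      neg_mem (sum_mem fun i _ => hsum m i)
    have h3 := Submodule.mem_map_of_mem (f := N.mkQ) h2
    rw [Submodule.map_smul''] at h3
    exact Submodule.smul_mono le_rfl le_top h3
  rw [← Submodule.Quotient.subsingleton_iff]
  exact (Submodule.subsingleton_iff R).1 (subsingleton_of_bot_eq_top htop.symm)

theorem value_one_add_sum_of_mem_jacobson {D : PolyLaw k R k}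
    (hmul : D.IsMultiplicative) {B : Type} [CommRing B] [Algebra k B]
    {ι : Type} [Fintype ι] (c : ι → B) {x : ι → R} (hx : ∀ i, x i ∈ Ring.jacobson R) :
    D.value B (1 + ∑ i, c i ⊗ₜ x i) = 1 := by
  let w : MvPolynomial ι k ⊗[k] R := 1 + ∑ i, MvPolynomial.X i ⊗ₜ x i
  have hext {C : Type} [CommRing C] [Algebra k C] (φ : MvPolynomial ι k →ₐ[k] C) :
      extend R φ w = 1 + ∑ i, φ (MvPolynomial.X i) ⊗ₜ x i := by
    simp [w]
  have hunit : IsUnit (D.value (MvPolynomial ι k) w) := by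
    by_contra hnot
    obtain ⟨M, hM, hmem⟩ := exists_max_ideal_of_mem_nonunits hnot
    let := Ideal.Quotient.field M
    have : Module.Finite k (MvPolynomial ι k ⧸ M) :=
      finite_of_finite_type_of_isJacobsonRing k (MvPolynomial ι k ⧸ M)
    have h1 := D.value_extend (Ideal.Quotient.mkₐ k M) w
    rw [hext, Ideal.Quotient.mkₐ_eq_mk, Ideal.Quotient.eq_zero_iff_mem.2 hmem] at h1
    obtain ⟨v, hv⟩ := exists_mul_one_add_eq_one (k := k)
      (fun i => Ideal.Quotient.mk M (MvPolynomial.X i)) hx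
    have h2 := hmul.isUnit_value hv
    rw [h1] at h2
    exact not_isUnit_zero h2
  obtain ⟨a, -, ha⟩ := MvPolynomial.isUnit_iff_eq_C_of_isReduced.1 hunit
  have ha1 : a = 1 := by
    have h1 := D.value_extend (MvPolynomial.aeval (fun _ : ι => (0 : k))) w
    rw [hext, ha] at h1
    simpa [hmul.value_one] using h1.symm
  have h1 := D.value_extend (MvPolynomial.aeval c) w
  rw [hext, ha, ha1] at h1
  simpa using h1

theorem value_one_add_mul_of_mem_jacobson {D : PolyLaw k R k}
    (hmul : D.IsMultiplicative) {B : Type} [CommRing B] [Algebra k B]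
    (a : B ⊗[k] R) (b : B) {x : R} (hx : x ∈ Ring.jacobson R) :
    D.value B (1 + a * (b ⊗ₜ x)) = 1 := by
  obtain ⟨S, rfl⟩ := TensorProduct.exists_finset a
  have h := value_one_add_sum_of_mem_jacobson hmul (ι := S)
    (fun i => i.1.1 * b) (x := fun i => i.1.2 * x) (fun i => Ideal.mul_mem_left _ _ hx)
  rw [Finset.sum_mul, ← Finset.sum_coe_sort]
  simpa using h

theorem IsCayleyHamilton.value_add_of_mem_jacobson {D : PolyLaw k R k} {d : ℕ}
    (hCH : D.IsCayleyHamilton d) (hhom : D.IsHomogeneous d)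
    (hmul : D.IsMultiplicative) {B : Type} [CommRing B] [IsDomain B] [Algebra k B]
    {x : R} (hx : x ∈ Ring.jacobson R) (b : B) (m : B ⊗[k] R) :
    D.value B (b ⊗ₜ x + m) = D.value B m := by
  let F := FractionRing (Polynomial B)
  let ι : Polynomial B →ₐ[k] F := IsScalarTower.toAlgHom k (Polynomial B) F
  let i : B →ₐ[k] Polynomial B := IsScalarTower.toAlgHom k B (Polynomial B)
  have hι : Function.Injective ι := IsFractionRing.injective (Polynomial B) F
  let z : Polynomial B ⊗[k] R := Polynomial.X ⊗ₜ 1 + extend R i m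
  obtain ⟨(u : (F ⊗[k] R)ˣ), hu⟩ := hCH.isUnit_X_add hhom hmul m
  have h1 : D.value (Polynomial B) (z + i b ⊗ₜ x) = D.value (Polynomial B) z := by
    apply hι
    rw [← value_extend, ← value_extend, map_add, extend_tmul, ← hu]
    have : (u : F ⊗[k] R) + ι (i b) ⊗ₜ x =
        (u : F ⊗[k] R) * (1 + ((u⁻¹ : (F ⊗[k] R)ˣ) : F ⊗[k] R) * (ι (i b) ⊗ₜ x)) := by
      rw [mul_add, mul_one, Units.mul_inv_cancel_left]
    rw [this, hmul.value_mul, value_one_add_mul_of_mem_jacobson hmul _ _ hx, mul_one]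
  let e : Polynomial B →ₐ[k] B := (Polynomial.aeval (R := B) 0).restrictScalars k
  have hei : e.comp i = AlgHom.id k B := by ext b; simp [e, i]
  have hz : extend R e z = m := by
    rw [map_add, extend_comp, hei, extend_id]
    simp [e]
  have hb : e (i b) = b := DFunLike.congr_fun hei b
  have h2 := congrArg e h1
  rwa [← value_extend, ← value_extend, map_add, hz, extend_tmul, hb, add_comm] at h2

theorem IsCayleyHamilton.jacobson_subset_ker {D : PolyLaw k R k} {d : ℕ}
    (hCH : D.IsCayleyHamilton d) (hhom : D.IsHomogeneous d)
    (hmul : D.IsMultiplicative) {x : R} (hx : x ∈ Ring.jacobson R) : x ∈ D.ker := by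
  rw [mem_ker_iff]
  intro B _ _ b m
  let φ : MvPolynomial B k →ₐ[k] B := MvPolynomial.aeval id
  have hφ : Function.Surjective φ := fun c => ⟨MvPolynomial.X c, by simp [φ]⟩
  obtain ⟨n, rfl⟩ : ∃ n, extend R φ n = m := LinearMap.rTensor_surjective R hφ m
  obtain ⟨c, rfl⟩ := hφ b
  rw [← extend_tmul, ← map_add, value_extend, value_extend,
    hCH.value_add_of_mem_jacobson hhom hmul hx]

end PolyLaw

/-- If `k` is a field and `D : R → k` a Cayley–Hamilton determinant of
dimension `d`, then `ker(D)` is the Jacobson radical of `R`. -/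
theorem cayleyHamilton_ker_eq_jacobson (k R : Type) [Field k] [Ring R] [Algebra k R]
    (d : ℕ) (D : PolyLaw k R k) (hhom : D.IsHomogeneous d) (hmul : D.IsMultiplicative)
    (hCH : D.IsCayleyHamilton d) :
    D.ker = {x : R | x ∈ Ideal.jacobson (⊥ : Ideal R)} := by
  ext x
  rw [Set.mem_ofPred_eq, Ideal.jacobson_bot]
  exact ⟨hCH.ker_subset_jacobson hhom hmul, hCH.jacobson_subset_ker hhom hmul⟩
end
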